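/- arXiv:1007.5302 — 2 statements merged into one kernel-verified Lean document; each statement's English description precedes it below -/
import Mathlib

section
/- Let n ≥ 1 and let f : ℝ^d → ℝ be bounded and measurable with all second order partial derivatives bounded and Hölder continuous with exponent α ∈ (0,1]. With E(s,x) := ∫_{ℝ^d} f(y) K^{BS}(s;x,y) dy, u(t,x) := 2ⁿ ∫_{(0,∞)ⁿ} E(s,x) ∏_{i=1}ⁿ K^{BM}(t_i;0,s_i) ds and 𝒰^{(j)}(t,x) := 2ⁿ ∫_{(0,∞)ⁿ} (∏_{i∈{1,…,n}\{j}} s_i)² E(s,x) ∏_{i=1}ⁿ K^{BM}(t_i;0,s_i) ds for j ∈ {1,…,n}, define for each j the terms T_{1,j}(t,x) := √((∏_{i∈{1,…,n}\{j}} t_i)/(2^{4−n} πⁿ t_j)) Δ_x f(x) and T_{2,j}(t,x) := (1/8) Δ_x² 𝒰^{(j)}(t,x), and let 𝕊_n := { (k₁,…,k_n) ∈ {1,2}ⁿ : n+1 ≤ k₁+⋯+k_n ≤ 2n−1 } (which is empty when n = 1). Then for every t ∈ (0,∞)ⁿ and x ∈ ℝ^d, ∏_{j=1}ⁿ ∂u/∂t_j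 (t,x) = √( (t₁⋯t_n)^{n−2} / (2^{4n−n²} π^{n²}) ) (Δ_x f(x))ⁿ + (1/8ⁿ) ∏_{j=1}ⁿ Δ_x² 𝒰^{(j)}(t,x) + ∑_{(k₁,…,k_n) ∈ 𝕊_n} ∏_{j=1}ⁿ T_{k_j,j}(t,x). -/
open MeasureTheory Real Filter Finset

noncomputable section

/-- Partial derivative of `g` in the `k`-th coordinate direction, at `x`. -/
def pd {m : ℕ} {E : Type*} [NormedAddCommGroup E] [NormedSpace ℝ E]
    (k : Fin m) (g : (Fin m → ℝ) → E) (x : Fin m → ℝ) : E :=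
  deriv (fun h : ℝ => g (Function.update x k h)) (x k)

/-- The Laplacian of `g : ℝ^m → E`, as the sum of its second coordinate partials. -/
def lap {m : ℕ} {E : Type*} [NormedAddCommGroup E] [NormedSpace ℝ E]
    (g : (Fin m → ℝ) → E) (x : Fin m → ℝ) : E :=
  ∑ k, pd k (pd k g) x

/-- The `n`-parameter `d`-dimensional Brownian sheet kernel
`K^{BS}(t;x,y) = (2π t₁⋯t_n)^{-d/2} exp(-|x-y|²/(2 t₁⋯t_n))`. -/
def Kbs (n d : ℕ) (t : Fin n → ℝ) (x y : Fin d → ℝ) : ℝ :=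
  (2 * π * ∏ i, t i) ^ (-(d : ℝ) / 2) *
    Real.exp (-(∑ k, (x k - y k) ^ 2) / (2 * ∏ i, t i))

/-- The one-dimensional heat (Brownian motion transition) kernel
`K^{BM}(t;0,s) = (2πt)^{-1/2} exp(-s²/(2t))`. -/
def Kbm (t s : ℝ) : ℝ :=
  (2 * π * t) ^ (-(1 : ℝ) / 2) * Real.exp (-(s ^ 2) / (2 * t))

/-- The `n`-parameter `d`-dimensional complex propagator kernel
`p_{is}(x,y) = (2πi s₁⋯s_n)^{-d/2} exp(-|x-y|²/(2i s₁⋯s_n))` (principal branch). -/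
def pProp (n d : ℕ) (s : Fin n → ℝ) (x y : Fin d → ℝ) : ℂ :=
  (2 * (π : ℂ) * Complex.I * ∏ i, (s i : ℂ)) ^ (-(d : ℂ) / 2) *
    Complex.exp (-((∑ k, (x k - y k) ^ 2 : ℝ) : ℂ) /
      (2 * Complex.I * ∏ i, (s i : ℂ)))

/-- `F'` is the partial derivative of `F` in the `k`-th direction, at every point. -/
def HasPd {m : ℕ} (k : Fin m) (F F' : (Fin m → ℝ) → ℝ) : Prop :=
  ∀ x, HasDerivAt (fun h : ℝ => F (Function.update x k h)) (F' x) (x k)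

lemma HasPd.pd_eq {m : ℕ} {k : Fin m} {F F' : (Fin m → ℝ) → ℝ} (h : HasPd k F F') :
    pd k F = F' := funext fun x => (h x).deriv

lemma HasPd.unique {m : ℕ} {k : Fin m} {F G H : (Fin m → ℝ) → ℝ} (h : HasPd k F G)
    (h' : HasPd k F H) : G = H := h.pd_eq.symm.trans h'.pd_eq

lemma HasPd.hasDerivAt {m : ℕ} {k : Fin m} {F F' : (Fin m → ℝ) → ℝ} (hF : HasPd k F F')
    (x : Fin m → ℝ) (h : ℝ) :
    HasDerivAt (fun h : ℝ => F (Function.update x k h)) (F' (Function.update x k h)) h := by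
  have := hF (Function.update x k h)
  simpa using this

lemma HasPd.const_mul {m : ℕ} {k : Fin m} {F F' : (Fin m → ℝ) → ℝ} (c : ℝ) (h : HasPd k F F') :
    HasPd k (fun x => c * F x) (fun x => c * F' x) :=
  fun x => (h x).const_mul c

lemma lap_eq_of_hasPd {m : ℕ} {F : (Fin m → ℝ) → ℝ} {F' F'' : Fin m → (Fin m → ℝ) → ℝ}
    (h : ∀ k, HasPd k F (F' k)) (h' : ∀ k, HasPd k (F' k) (F'' k)) :
    lap F = fun x => ∑ k, F'' k x := by
  funext x
  unfold lap
  exact Finset.sum_congr rfl fun k _ => by rw [(h k).pd_eq, (h' k).pd_eq]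

/-- A bounded function with bounded derivatives of second order in a direction has a bounded
derivative of first order in that direction. -/
lemma HasPd.abs_le_of_second {m : ℕ} {k : Fin m} {F F' F'' : (Fin m → ℝ) → ℝ} {A B : ℝ}
    (h : HasPd k F F') (h' : HasPd k F' F'') (hA : ∀ x, |F x| ≤ A) (hB : ∀ x, |F'' x| ≤ B)
    (x : Fin m → ℝ) : |F' x| ≤ 2 * A + B := by
  have hd := fun t => h.hasDerivAt x t
  have hd' := fun t => h'.hasDerivAt x t
  obtain ⟨c, hc, hce⟩ := exists_hasDerivAt_eq_slope _ _ (lt_add_one (x k))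
    (fun t _ => (hd t).continuousAt.continuousWithinAt) (fun t _ => hd t)
  obtain ⟨e, -, hee⟩ := exists_hasDerivAt_eq_slope _ _ hc.1
    (fun t _ => (hd' t).continuousAt.continuousWithinAt) (fun t _ => hd' t)
  have hpos : 0 < c - x k := sub_pos.2 hc.1
  rw [eq_div_iff hpos.ne'] at hee
  simp only [Function.update_eq_self, add_sub_cancel_left, div_one] at hce hee
  have h1 := abs_le.1 (hA (Function.update x k (x k + 1)))
  have h2 := abs_le.1 (hA x)
  have h3 : |F'' (Function.update x k e) * (c - x k)| ≤ B := by
    rw [abs_mul, abs_of_pos hpos]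
    nlinarith [hB (Function.update x k e), abs_nonneg (F'' (Function.update x k e)), hc.2]
  have h3 := abs_le.1 h3
  rw [abs_le]
  constructor <;> linarith

lemma measurable_update_right {m : ℕ} (k : Fin m) (φ : (Fin m → ℝ) → ℝ) (hφ : Measurable φ) :
    Measurable fun x : Fin m → ℝ => Function.update x k (φ x) := by
  rw [measurable_pi_iff]
  intro i
  rcases eq_or_ne i k with rfl | h
  · simpa using hφ
  · simpa [Function.update_of_ne h] using measurable_pi_apply i

lemma HasPd.measurable {m : ℕ} {k : Fin m} {F F' : (Fin m → ℝ) → ℝ}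
    (h : HasPd k F F') (hF : Measurable F) : Measurable F' := by
  have hlim : ∀ x, Tendsto (fun N : ℕ => ((1 : ℝ) / (N + 1))⁻¹ *
      (F (Function.update x k (x k + 1 / ((N : ℝ) + 1))) - F x)) atTop (nhds (F' x)) := by
    intro x
    have h1 := hasDerivAt_iff_tendsto_slope_zero.1 (h x)
    have h2 : Tendsto (fun N : ℕ => (1 : ℝ) / (N + 1)) atTop (nhdsWithin 0 {0}ᶜ) :=
      tendsto_nhdsWithin_iff.2 ⟨tendsto_one_div_add_atTop_nhds_zero_nat,
        Eventually.of_forall fun N => by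
          simp only [Set.mem_compl_iff, Set.mem_singleton_iff]; positivity⟩
    have h3 := h1.comp h2
    simpa [Function.comp_def] using h3
  refine measurable_of_tendsto_metrizable (fun N => ?_) (tendsto_pi_nhds.2 hlim)
  exact ((hF.comp (measurable_update_right k _ (by fun_prop))).sub hF).const_mul _

/-- Differentiation under the integral sign in a coordinate direction. -/
lemma HasPd.integral {m : ℕ} {k : Fin m} {Ω : Type*} [MeasurableSpace Ω] {μ : Measure Ω}
    {F F' : Ω → (Fin m → ℝ) → ℝ} (h : ∀ᵐ ω ∂μ, HasPd k (F ω) (F' ω))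
    (hF : ∀ x, AEStronglyMeasurable (fun ω => F ω x) μ)
    (hF' : ∀ x, AEStronglyMeasurable (fun ω => F' ω x) μ)
    (hint : ∀ x, Integrable (fun ω => F ω x) μ)
    (hbound : ∀ x, ∃ b : Ω → ℝ, Integrable b μ ∧
      ∀ᵐ ω ∂μ, ∀ h : ℝ, |h - x k| < 1 → |F' ω (Function.update x k h)| ≤ b ω) :
    HasPd k (fun x => ∫ ω, F ω x ∂μ) (fun x => ∫ ω, F' ω x ∂μ) := by
  intro x
  obtain ⟨b, hb, hFb⟩ := hbound x
  have := (hasDerivAt_integral_of_dominated_loc_of_deriv_le (μ := μ)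
    (F := fun h ω => F ω (Function.update x k h)) (F' := fun h ω => F' ω (Function.update x k h))
    (x₀ := x k) (bound := b) (Metric.ball_mem_nhds _ one_pos)
    (Eventually.of_forall fun t => hF _) (hint _) (hF' _)
    (by
      filter_upwards [hFb] with ω hω t ht
      exact hω t (by simpa [Real.dist_eq] using ht)) hb
    (by
      filter_upwards [h] with ω hω t _
      exact hω.hasDerivAt x t)).2
  simpa using this

section HeatKernel

variable {d : ℕ}

/-- The heat kernel in dimension `c` at time `τ`, as a function of the squared distance `q`. -/
def radialHeat (c τ q : ℝ) : ℝ := (2 * π * τ) ^ (-c / 2) * Real.exp (-q / (2 * τ))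

lemma radialHeat_nonneg {c τ q : ℝ} (hτ : 0 < τ) : 0 ≤ radialHeat c τ q := by
  unfold radialHeat; positivity

lemma hasDerivAt_radialHeat (c q : ℝ) {τ : ℝ} (hτ : 0 < τ) :
    HasDerivAt (fun τ => radialHeat c τ q)
      ((1 / 2) * (q / τ ^ 2 - c / τ) * radialHeat c τ q) τ := by
  unfold radialHeat
  have h2 : 2 * π * τ ≠ 0 := by positivity
  have h1 : HasDerivAt (fun τ : ℝ => (2 * π * τ) ^ (-c / 2))
      (2 * π * 1 * (-c / 2) * (2 * π * τ) ^ (-c / 2 - 1)) τ :=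
    ((hasDerivAt_id τ).const_mul (2 * π)).rpow_const (Or.inl h2)
  have h3 : HasDerivAt (fun τ : ℝ => Real.exp (-q / (2 * τ)))
      (Real.exp (-q / (2 * τ)) * ((0 * (2 * τ) - (-q) * (2 * 1)) / (2 * τ) ^ 2)) τ :=
    (((hasDerivAt_const τ (-q)).div ((hasDerivAt_id τ).const_mul 2) (by simpa using hτ.ne'))).exp
  refine (h1.mul h3).congr_deriv ?_
  rw [Real.rpow_sub_one h2]
  field_simp
  ring

lemma one_add_le_mul_exp {b q : ℝ} (hb : 0 < b) (hq : 0 ≤ q) :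
    1 + q ≤ (1 + 1 / b) * Real.exp (b * q) := by
  have h1 := Real.add_one_le_exp (b * q)
  have h2 : (1 + 1 / b) * (b * q + 1) ≤ (1 + 1 / b) * Real.exp (b * q) := by gcongr
  have h3 : (1 + 1 / b) * (b * q + 1) = 1 + q + b * q + 1 / b := by field_simp; ring
  have : 0 < 1 / b := by positivity
  nlinarith [mul_nonneg hb.le hq]

/-- A bound for the time derivative of the heat kernel, locally uniform in time. -/
lemma exists_abs_deriv_radialHeat_le (c : ℝ) {τ₀ : ℝ} (hτ₀ : 0 < τ₀) (hc : 0 ≤ c) :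
    ∃ C, 0 ≤ C ∧ ∀ τ q, |τ - τ₀| < τ₀ / 2 → 0 ≤ q →
      |(1 / 2) * (q / τ ^ 2 - c / τ) * radialHeat c τ q| ≤
        C * Real.exp (-(1 / (6 * τ₀)) * q) := by
  have hK : 0 < 4 / τ₀ ^ 2 + 2 * c / τ₀ := by positivity
  refine ⟨(4 / τ₀ ^ 2 + 2 * c / τ₀) * (π * τ₀) ^ (-c / 2) * (1 + 6 * τ₀), by positivity, ?_⟩
  intro τ q hτ hq
  obtain ⟨h1, h2⟩ := abs_lt.1 hτ
  have hlo : τ₀ / 2 ≤ τ := by linarith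
  have hpos : 0 < τ := by linarith
  have ha : |(1 / 2) * (q / τ ^ 2 - c / τ)| ≤ (4 / τ₀ ^ 2 + 2 * c / τ₀) * (1 + q) := by
    have e1 : q / τ ^ 2 ≤ q / (τ₀ / 2) ^ 2 := by gcongr
    have e2 : c / τ ≤ c / (τ₀ / 2) := by gcongr
    have e3 : q / (τ₀ / 2) ^ 2 = 4 / τ₀ ^ 2 * q := by field_simp; norm_num
    have e4 : c / (τ₀ / 2) = 2 * c / τ₀ := by field_simp
    have e5 : 0 ≤ q / τ ^ 2 := by positivity
    have e6 : 0 ≤ c / τ := by positivity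
    have e7 : 0 ≤ 4 / τ₀ ^ 2 := by positivity
    have e8 : 0 ≤ 2 * c / τ₀ * q := by positivity
    rw [abs_le]
    constructor <;> nlinarith
  have hb : (2 * π * τ) ^ (-c / 2) ≤ (π * τ₀) ^ (-c / 2) := by
    apply Real.rpow_le_rpow_of_nonpos (by positivity) _ (by linarith)
    nlinarith [Real.pi_pos]
  have hexp : Real.exp (-q / (2 * τ)) ≤ Real.exp (-(2 * (1 / (6 * τ₀)) * q)) := by
    apply Real.exp_le_exp.2
    rw [neg_div, neg_le_neg_iff]
    have : 2 * (1 / (6 * τ₀)) * q = q / (3 * τ₀) := by field_simp; ring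
    rw [this]
    exact div_le_div_of_nonneg_left hq (by positivity) (by linarith)
  have hlin := one_add_le_mul_exp (b := 1 / (6 * τ₀)) (by positivity) hq
  unfold radialHeat
  rw [abs_mul, abs_of_nonneg (a := (2 * π * τ) ^ (-c / 2) * _) (by positivity)]
  calc _ ≤ ((4 / τ₀ ^ 2 + 2 * c / τ₀) * ((1 + 1 / (1 / (6 * τ₀))) * Real.exp (1 / (6 * τ₀) * q))) *
        ((π * τ₀) ^ (-c / 2) * Real.exp (-(2 * (1 / (6 * τ₀)) * q))) := by
        gcongr
        exact ha.trans (by gcongr)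
    _ = (4 / τ₀ ^ 2 + 2 * c / τ₀) * (π * τ₀) ^ (-c / 2) * (1 + 6 * τ₀) *
        (Real.exp (1 / (6 * τ₀) * q) * Real.exp (-(2 * (1 / (6 * τ₀)) * q))) := by
        rw [one_div_one_div]; ring
    _ = _ := by
        rw [← Real.exp_add]; congr 2; ring

/-- The squared Euclidean norm of `w`. -/
def normSq (w : Fin d → ℝ) : ℝ := ∑ k, w k ^ 2

lemma normSq_nonneg (w : Fin d → ℝ) : 0 ≤ normSq w := Finset.sum_nonneg fun _ _ => sq_nonneg _

lemma sq_le_normSq (w : Fin d → ℝ) (k : Fin d) : w k ^ 2 ≤ normSq w :=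
  Finset.single_le_sum (f := fun k => w k ^ 2) (fun _ _ => sq_nonneg _) (Finset.mem_univ k)

lemma norm_sq_le_normSq (w : Fin d → ℝ) : ‖w‖ ^ 2 ≤ normSq w := by
  have : ‖w‖ ≤ √(normSq w) := (pi_norm_le_iff_of_nonneg (Real.sqrt_nonneg _)).2 fun k =>
    Real.abs_le_sqrt (sq_le_normSq w k)
  calc ‖w‖ ^ 2 ≤ √(normSq w) ^ 2 := by gcongr
    _ = _ := Real.sq_sqrt (normSq_nonneg w)

lemma measurable_normSq : Measurable (normSq : (Fin d → ℝ) → ℝ) := by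
  unfold normSq; fun_prop

lemma normSq_smul (r : ℝ) (w : Fin d → ℝ) : normSq (r • w) = r ^ 2 * normSq w := by
  simp [normSq, mul_pow, Finset.mul_sum]

/-- The heat kernel on `ℝ^d`. -/
def heat (τ : ℝ) (w : Fin d → ℝ) : ℝ := radialHeat d τ (normSq w)

lemma heat_nonneg {τ : ℝ} (hτ : 0 < τ) (w : Fin d → ℝ) : 0 ≤ heat τ w := radialHeat_nonneg hτ

lemma measurable_heat : Measurable fun p : ℝ × (Fin d → ℝ) => heat p.1 p.2 := by
  have := measurable_normSq (d := d)
  unfold heat radialHeat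
  fun_prop

lemma Kbs_eq_heat (n : ℕ) (s : Fin n → ℝ) (x y : Fin d → ℝ) :
    Kbs n d s x y = heat (∏ i, s i) (x - y) := rfl

lemma integrable_exp_neg_mul_normSq {b : ℝ} (hb : 0 < b) :
    Integrable fun w : Fin d → ℝ => Real.exp (-b * normSq w) := by
  have := Integrable.fintype_prod (ι := Fin d) (f := fun _ (x : ℝ) => Real.exp (-b * x ^ 2))
    (μ := fun _ => volume) (fun _ => integrable_exp_neg_mul_sq hb)
  simpa only [normSq, Finset.mul_sum, Real.exp_sum, ← volume_pi] using this

lemma exists_mul_exp_le {b : ℝ} (hb : 0 < b) :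
    ∃ C, 0 ≤ C ∧ ∀ q, 0 ≤ q → (1 + q) ^ 2 * Real.exp (-b * q) ≤ C * Real.exp (-(b / 2) * q) := by
  refine ⟨(1 + 1 / (b / 4)) ^ 2, by positivity, fun q hq => ?_⟩
  have h := one_add_le_mul_exp (b := b / 4) (by positivity) hq
  calc _ ≤ ((1 + 1 / (b / 4)) * Real.exp (b / 4 * q)) ^ 2 * Real.exp (-b * q) := by gcongr
    _ = (1 + 1 / (b / 4)) ^ 2 * (Real.exp (b / 4 * q) * Real.exp (b / 4 * q)
        * Real.exp (-b * q)) := by ring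
    _ = _ := by rw [← Real.exp_add, ← Real.exp_add]; congr 2; ring

lemma exists_mul_heat_le {τ : ℝ} (hτ : 0 < τ) :
    ∃ C, 0 ≤ C ∧ ∀ w : Fin d → ℝ,
      (1 + normSq w) ^ 2 * heat τ w ≤ C * Real.exp (-(1 / (4 * τ)) * normSq w) := by
  obtain ⟨C, hC, h⟩ := exists_mul_exp_le (b := 1 / (2 * τ)) (by positivity)
  refine ⟨(2 * π * τ) ^ (-(d : ℝ) / 2) * C, by positivity, fun w => ?_⟩
  rw [heat, radialHeat]
  calc _ = (2 * π * τ) ^ (-(d : ℝ) / 2) *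
          ((1 + normSq w) ^ 2 * Real.exp (-(1 / (2 * τ)) * normSq w)) := by
        rw [show -normSq w / (2 * τ) = -(1 / (2 * τ)) * normSq w by ring]; ring
    _ ≤ (2 * π * τ) ^ (-(d : ℝ) / 2) * (C * Real.exp (-(1 / (2 * τ) / 2) * normSq w)) :=
        mul_le_mul_of_nonneg_left (h _ (normSq_nonneg w)) (by positivity)
    _ = _ := by
        rw [show 1 / (2 * τ) / 2 = 1 / (4 * τ) by field_simp; norm_num]; ring

lemma nonneg_of_abs_le {φ : (Fin d → ℝ) → ℝ} {A : ℝ}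
    (hA : ∀ w, |φ w| ≤ A * (1 + normSq w) ^ 2) : 0 ≤ A := by
  have := (abs_nonneg _).trans (hA 0)
  simpa [normSq] using this

/-- A function of at most quartic growth is integrable against the heat kernel. -/
lemma integrable_mul_heat {τ : ℝ} (hτ : 0 < τ) {φ : (Fin d → ℝ) → ℝ} (hφ : Measurable φ) {A : ℝ}
    (hA : ∀ w, |φ w| ≤ A * (1 + normSq w) ^ 2) : Integrable fun w => φ w * heat τ w := by
  obtain ⟨C, hC, h⟩ := exists_mul_heat_le (d := d) hτ
  have hA0 := nonneg_of_abs_le hA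
  refine Integrable.mono' ((integrable_exp_neg_mul_normSq (d := d)
    (b := 1 / (4 * τ)) (by positivity)).const_mul (A * C)) ?_ ?_
  · exact (hφ.mul (measurable_heat.comp (measurable_const.prodMk measurable_id))).aestronglyMeasurable
  · refine Eventually.of_forall fun w => ?_
    rw [Real.norm_eq_abs, abs_mul, abs_of_nonneg (heat_nonneg hτ w)]
    calc _ ≤ A * (1 + normSq w) ^ 2 * heat τ w :=
          mul_le_mul_of_nonneg_right (hA w) (heat_nonneg hτ w)
      _ = A * ((1 + normSq w) ^ 2 * heat τ w) := by ring
      _ ≤ A * (C * Real.exp (-(1 / (4 * τ)) * normSq w)) := mul_le_mul_of_nonneg_left (h w) hA0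
      _ = _ := by ring

lemma integral_heat_one : ∫ z : Fin d → ℝ, heat 1 z = 1 := by
  have h := integral_fintype_prod_eq_prod (ι := Fin d) (𝕜 := ℝ)
    (fun _ (x : ℝ) => Real.exp (-(1 / 2) * x ^ 2)) (μ := fun _ => volume)
  simp only [← Real.exp_sum, ← Finset.mul_sum, integral_gaussian, Finset.prod_const,
    Finset.card_univ, Fintype.card_fin, ← volume_pi] at h
  simp only [heat, radialHeat, normSq, mul_one, integral_const_mul]
  simp only [show ∀ a : ℝ, -a / 2 = -(1 / 2) * a from fun a => by ring, h]
  rw [Real.sqrt_eq_rpow, ← Real.rpow_natCast, ← Real.rpow_mul (by positivity),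
    show π / (1 / 2) = 2 * π by ring, ← Real.rpow_add (by positivity)]
  ring_nf
  simp

lemma heat_sqrt_smul {τ : ℝ} (hτ : 0 < τ) (z : Fin d → ℝ) :
    √τ ^ d * heat τ (√τ • z) = heat 1 z := by
  simp only [heat, radialHeat, normSq_smul, Real.sq_sqrt hτ.le, mul_one]
  rw [Real.mul_rpow (by positivity) hτ.le, Real.sqrt_eq_rpow, ← Real.rpow_natCast,
    ← Real.rpow_mul hτ.le]
  have h1 : τ ^ (1 / 2 * (d : ℝ)) * τ ^ (-(d : ℝ) / 2) = 1 := by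
    rw [← Real.rpow_add hτ]; ring_nf; simp
  have h2 : -(τ * normSq z) / (2 * τ) = -normSq z / 2 := by field_simp
  rw [h2]
  linear_combination (2 * π) ^ (-(d : ℝ) / 2) * Real.exp (-normSq z / 2) * h1

/-- The integral of `g` against the heat kernel with weight `φ`, centred at `x`. -/
def heatInt (φ : (Fin d → ℝ) → ℝ) (g : (Fin d → ℝ) → ℝ) (τ : ℝ) (x : Fin d → ℝ) : ℝ :=
  ∫ y, g y * (φ (x - y) * heat τ (x - y))

/-- The heat semigroup, including time zero. -/
def heatSg (g : (Fin d → ℝ) → ℝ) (τ : ℝ) (x : Fin d → ℝ) : ℝ :=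
  ∫ z, g (x - √τ • z) * heat 1 z

lemma heatInt_eq_scaled {τ : ℝ} (hτ : 0 < τ) (φ g : (Fin d → ℝ) → ℝ) (x : Fin d → ℝ) :
    heatInt φ g τ x = ∫ z, g (x - √τ • z) * (φ (√τ • z) * heat 1 z) := by
  have h1 := integral_sub_left_eq_self (fun w => g (x - w) * (φ w * heat τ w)) volume x
  simp only [sub_sub_cancel] at h1
  have h2 := Measure.integral_comp_smul (volume : Measure (Fin d → ℝ))
    (fun w => g (x - w) * (φ w * heat τ w)) (√τ)
  have hs : 0 < √τ ^ d := by positivity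
  rw [Module.finrank_fin_fun, smul_eq_mul, abs_of_pos (by positivity)] at h2
  rw [heatInt, h1]
  have h3 : ∀ z : Fin d → ℝ, g (x - √τ • z) * (φ (√τ • z) * heat 1 z) =
      √τ ^ d * (g (x - √τ • z) * (φ (√τ • z) * heat τ (√τ • z))) := fun z => by
    rw [← heat_sqrt_smul hτ]; ring
  simp only [h3, integral_const_mul]
  rw [h2, mul_inv_cancel_left₀ hs.ne']

lemma heatInt_one_eq_heatSg {τ : ℝ} (hτ : 0 < τ) (g : (Fin d → ℝ) → ℝ) (x : Fin d → ℝ) :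
    heatInt (fun _ => 1) g τ x = heatSg g τ x := by
  simp only [heatInt_eq_scaled hτ, heatSg, one_mul]

lemma heatSg_zero (g : (Fin d → ℝ) → ℝ) (x : Fin d → ℝ) : heatSg g 0 x = g x := by
  simp [heatSg, integral_const_mul, integral_heat_one]

lemma integrable_heat {τ : ℝ} (hτ : 0 < τ) : Integrable (heat τ : (Fin d → ℝ) → ℝ) := by
  have := integrable_mul_heat (d := d) hτ (φ := fun _ => 1) measurable_const (A := 1)
    (fun w => by
      have := normSq_nonneg w
      simp only [abs_one]; nlinarith)
  simpa using this

lemma measurable_heat_one : Measurable (heat 1 : (Fin d → ℝ) → ℝ) :=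
  measurable_heat.comp (measurable_const.prodMk measurable_id)

lemma norm_mul_heat_le {M : ℝ} {a : ℝ} (ha : |a| ≤ M) (z : Fin d → ℝ) :
    ‖a * heat 1 z‖ ≤ M * heat 1 z := by
  rw [norm_mul, Real.norm_eq_abs, Real.norm_of_nonneg (heat_nonneg one_pos z)]
  exact mul_le_mul_of_nonneg_right ha (heat_nonneg one_pos z)

lemma abs_heatSg_le {g : (Fin d → ℝ) → ℝ} {M : ℝ} (hM : ∀ x, |g x| ≤ M)
    (τ : ℝ) (x : Fin d → ℝ) : |heatSg g τ x| ≤ M := by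
  have h := norm_integral_le_of_norm_le ((integrable_heat (d := d) one_pos).const_mul M)
    (f := fun z => g (x - √τ • z) * heat 1 z)
    (Eventually.of_forall fun z => norm_mul_heat_le (hM _) z)
  rwa [integral_const_mul, integral_heat_one, mul_one] at h

lemma continuous_heatSg {g : (Fin d → ℝ) → ℝ} {M : ℝ} (hg : Continuous g)
    (hM : ∀ x, |g x| ≤ M) (x : Fin d → ℝ) : Continuous fun τ => heatSg g τ x := by
  unfold heatSg
  refine continuous_of_dominated (bound := fun z => M * heat 1 z) (fun τ => ?_)
    (fun τ => Eventually.of_forall fun z => norm_mul_heat_le (hM _) z)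
    ((integrable_heat one_pos).const_mul M) (Eventually.of_forall fun z => ?_)
  · exact ((hg.measurable.comp (by fun_prop)).mul measurable_heat_one).aestronglyMeasurable
  · exact (hg.comp (by fun_prop)).mul continuous_const

lemma measurable_heatSg {g : (Fin d → ℝ) → ℝ} (hg : Measurable g) (x : Fin d → ℝ) :
    Measurable fun τ => heatSg g τ x := by
  have : Measurable (Function.uncurry fun (τ : ℝ) (z : Fin d → ℝ) =>
      g (x - √τ • z) * heat 1 z) :=
    (hg.comp (by fun_prop)).mul (measurable_heat_one.comp measurable_snd)
  exact this.stronglyMeasurable.integral_prod_right.measurable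

lemma measurable_heatInt {φ : ℝ → (Fin d → ℝ) → ℝ} (hφ : Measurable (Function.uncurry φ))
    {g : (Fin d → ℝ) → ℝ} (hg : Measurable g) (x : Fin d → ℝ) :
    Measurable fun τ => heatInt (φ τ) g τ x := by
  have hsub : Measurable fun p : ℝ × (Fin d → ℝ) => (p.1, x - p.2) := by fun_prop
  have : Measurable (Function.uncurry fun (τ : ℝ) (y : Fin d → ℝ) =>
      g y * (φ τ (x - y) * heat τ (x - y))) :=
    (hg.comp measurable_snd).mul ((hφ.comp hsub).mul (measurable_heat.comp hsub))
  exact this.stronglyMeasurable.integral_prod_right.measurable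

lemma HasPd.comp_sub {k : Fin d} {F F' : (Fin d → ℝ) → ℝ} (h : HasPd k F F') (y : Fin d → ℝ) :
    HasPd k (fun x => F (x - y)) (fun x => F' (x - y)) := by
  intro x
  have h1 := h (x - y)
  have h2 : (fun t : ℝ => F (Function.update x k t - y)) =
      fun t => F (Function.update (x - y) k (t - y k)) := by
    funext t
    congr 1
    ext i
    rcases eq_or_ne i k with rfl | hi
    · simp
    · simp [Function.update_of_ne hi]
  rw [h2]
  exact HasDerivAt.comp_sub_const (f := fun t => F (Function.update (x - y) k t)) _ _ h1

/-- The heat semigroup commutes with partial derivatives. -/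
lemma HasPd.heatSg {k : Fin d} {g g' : (Fin d → ℝ) → ℝ} (h : HasPd k g g') (hg : Measurable g)
    {M M' : ℝ} (hM : ∀ x, |g x| ≤ M) (hM' : ∀ x, |g' x| ≤ M') (τ : ℝ) :
    HasPd k (heatSg g τ) (heatSg g' τ) := by
  have meas : ∀ φ : (Fin d → ℝ) → ℝ, Measurable φ → ∀ x : Fin d → ℝ,
      AEStronglyMeasurable (fun z : Fin d → ℝ => φ (x - √τ • z) * heat 1 z) volume := fun φ hφ x =>
    ((hφ.comp (by fun_prop)).mul measurable_heat_one).aestronglyMeasurable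
  refine HasPd.integral (Eventually.of_forall fun z => ?_) (meas g hg)
    (meas g' (h.measurable hg)) (fun x => ?_) (fun x => ?_)
  · exact fun x => (h.comp_sub (√τ • z) x).mul_const _
  · exact ((integrable_heat one_pos).const_mul M).mono' (meas g hg x)
      (Eventually.of_forall fun z => norm_mul_heat_le (hM _) z)
  · exact ⟨_, (integrable_heat one_pos).const_mul M',
      Eventually.of_forall fun z t _ => norm_mul_heat_le (hM' _) z⟩

lemma integrable_mul_mul_heat {τ : ℝ} (hτ : 0 < τ) {φ : (Fin d → ℝ) → ℝ} (hφ : Measurable φ)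
    {A : ℝ} (hA : ∀ w, |φ w| ≤ A * (1 + normSq w) ^ 2) {g : (Fin d → ℝ) → ℝ} (hg : Measurable g)
    {M : ℝ} (hM : ∀ x, |g x| ≤ M) (x : Fin d → ℝ) :
    Integrable fun y => g y * (φ (x - y) * heat τ (x - y)) :=
  ((integrable_mul_heat hτ hφ hA).comp_sub_left x).bdd_mul hg.aestronglyMeasurable
    (Eventually.of_forall hM)

lemma normSq_sub_le_update (x y : Fin d → ℝ) (k : Fin d) {h : ℝ} (hh : |h - x k| < 1) :
    normSq (x - y) ≤ 2 * normSq (Function.update x k h - y) + 2 := by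
  have h1 : ∀ i, (x - y) i ^ 2 ≤ 2 * (Function.update x k h - y) i ^ 2 + if i = k then 2 else 0 := by
    intro i
    obtain ⟨h2, h3⟩ := abs_lt.1 hh
    rcases eq_or_ne i k with rfl | hi
    · simp only [Pi.sub_apply, Function.update_self, if_true]
      nlinarith [sq_nonneg (2 * (h - y i) - (x i - y i))]
    · simp only [Pi.sub_apply, Function.update_of_ne hi, if_neg hi]
      nlinarith [sq_nonneg (x i - y i)]
  calc normSq (x - y) ≤ ∑ i, (2 * (Function.update x k h - y) i ^ 2 + if i = k then 2 else 0) :=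
        Finset.sum_le_sum fun i _ => h1 i
    _ = _ := by simp [normSq, Finset.sum_add_distrib, Finset.mul_sum]

lemma HasPd.heatInt {k : Fin d} {τ : ℝ} (hτ : 0 < τ) {φ φ' : (Fin d → ℝ) → ℝ}
    (h : HasPd k (fun w => φ w * heat τ w) (fun w => φ' w * heat τ w))
    (hφ : Measurable φ) (hφ' : Measurable φ') {A A' : ℝ}
    (hA : ∀ w, |φ w| ≤ A * (1 + normSq w) ^ 2) (hA' : ∀ w, |φ' w| ≤ A' * (1 + normSq w) ^ 2)
    {g : (Fin d → ℝ) → ℝ} (hg : Measurable g) {M : ℝ} (hM : ∀ x, |g x| ≤ M) :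
    HasPd k (heatInt φ g τ) (heatInt φ' g τ) := by
  refine HasPd.integral (Eventually.of_forall fun y x => (h.comp_sub y x).const_mul (g y))
    (fun x => (integrable_mul_mul_heat hτ hφ hA hg hM x).aestronglyMeasurable)
    (fun x => (integrable_mul_mul_heat hτ hφ' hA' hg hM x).aestronglyMeasurable)
    (fun x => integrable_mul_mul_heat hτ hφ hA hg hM x) (fun x => ?_)
  obtain ⟨C, hC, hCw⟩ := exists_mul_heat_le (d := d) hτ
  have hA0 := nonneg_of_abs_le hA'
  have hM0 := (abs_nonneg _).trans (hM 0)
  refine ⟨fun y => M * (A' * (C * Real.exp (1 / (4 * τ)))) *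
    Real.exp (-(1 / (8 * τ)) * normSq (x - y)),
    ((integrable_exp_neg_mul_normSq (by positivity)).comp_sub_left x).const_mul _,
    Eventually.of_forall fun y t ht => ?_⟩
  set w := Function.update x k t - y
  have hq := normSq_sub_le_update x y k ht
  have hexp : Real.exp (-(1 / (4 * τ)) * normSq w) ≤
      Real.exp (1 / (4 * τ)) * Real.exp (-(1 / (8 * τ)) * normSq (x - y)) := by
    rw [← Real.exp_add]
    apply Real.exp_le_exp.2
    have e : 1 / (8 * τ) = 1 / (4 * τ) / 2 := by field_simp; norm_num
    have : 0 < 1 / (4 * τ) := by positivity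
    rw [e]
    nlinarith
  rw [abs_mul, abs_mul, abs_of_nonneg (heat_nonneg hτ w)]
  have h0 := heat_nonneg hτ w
  calc |g y| * (|φ' w| * heat τ w) ≤ M * (A' * (1 + normSq w) ^ 2 * heat τ w) := by
        gcongr
        · exact hM y
        · exact hA' w
    _ = M * (A' * ((1 + normSq w) ^ 2 * heat τ w)) := by ring
    _ ≤ M * (A' * (C * (Real.exp (1 / (4 * τ)) *
          Real.exp (-(1 / (8 * τ)) * normSq (x - y))))) := by
        have := (hCw w).trans (mul_le_mul_of_nonneg_left hexp hC)
        exact mul_le_mul_of_nonneg_left (mul_le_mul_of_nonneg_left this hA0) hM0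
    _ = _ := by ring

/-- The weight whose product with the heat kernel is its first partial derivative. -/
def weight₁ (k : Fin d) (τ : ℝ) (w : Fin d → ℝ) : ℝ := -(w k) / τ

/-- The weight whose product with the heat kernel is its second partial derivative. -/
def weight₂ (k : Fin d) (τ : ℝ) (w : Fin d → ℝ) : ℝ := w k ^ 2 / τ ^ 2 - 1 / τ

lemma measurable_weight₁ (k : Fin d) : Measurable (Function.uncurry (weight₁ k)) := by
  unfold weight₁ Function.uncurry; fun_prop

lemma measurable_weight₂ (k : Fin d) : Measurable (Function.uncurry (weight₂ k)) := by
  unfold weight₂ Function.uncurry; fun_prop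

lemma measurable_weight₁_apply (k : Fin d) (τ : ℝ) : Measurable (weight₁ k τ) := by
  unfold weight₁; fun_prop

lemma measurable_weight₂_apply (k : Fin d) (τ : ℝ) : Measurable (weight₂ k τ) := by
  unfold weight₂; fun_prop

lemma abs_one_le_growth (w : Fin d → ℝ) : |(1 : ℝ)| ≤ 1 * (1 + normSq w) ^ 2 := by
  have := normSq_nonneg w
  rw [abs_one]; nlinarith

lemma abs_weight₁_le (k : Fin d) {τ : ℝ} (hτ : 0 < τ) (w : Fin d → ℝ) :
    |weight₁ k τ w| ≤ 1 / τ * (1 + normSq w) ^ 2 := by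
  have h1 := normSq_nonneg w
  have h2 := sq_le_normSq w k
  have h3 : |w k| ≤ (1 + normSq w) ^ 2 := by
    rw [abs_le]; constructor <;> nlinarith [sq_nonneg (w k - 1), sq_nonneg (w k + 1)]
  rw [weight₁, abs_div, abs_neg, abs_of_pos hτ, div_mul_eq_mul_div, one_mul]
  gcongr

lemma abs_weight₂_le (k : Fin d) {τ : ℝ} (hτ : 0 < τ) (w : Fin d → ℝ) :
    |weight₂ k τ w| ≤ (1 / τ ^ 2 + 1 / τ) * (1 + normSq w) ^ 2 := by
  have h1 := normSq_nonneg w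
  have h2 := sq_le_normSq w k
  have h3 : w k ^ 2 / τ ^ 2 ≤ normSq w / τ ^ 2 := by gcongr
  have h4 : 0 ≤ w k ^ 2 / τ ^ 2 := by positivity
  have h5 : 0 < 1 / τ := by positivity
  have h6 : 0 < 1 / τ ^ 2 := by positivity
  have h7 : normSq w / τ ^ 2 = 1 / τ ^ 2 * normSq w := by ring
  have h8 : normSq w ≤ (1 + normSq w) ^ 2 := by nlinarith
  have h9 : 1 ≤ (1 + normSq w) ^ 2 := by nlinarith
  rw [weight₂, abs_le]
  constructor <;>
    nlinarith [mul_le_mul_of_nonneg_left h8 h6.le, mul_le_mul_of_nonneg_left h9 h5.le,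
      mul_nonneg h5.le (sq_nonneg (1 + normSq w)), mul_nonneg h6.le (sq_nonneg (1 + normSq w))]

lemma hasPd_normSq (k : Fin d) : HasPd k normSq (fun w => 2 * w k) := by
  intro w
  have h1 : (fun h : ℝ => normSq (Function.update w k h)) =
      fun h => h ^ 2 + ∑ i ∈ Finset.univ.erase k, w i ^ 2 := by
    funext h
    rw [normSq, ← Finset.add_sum_erase _ _ (Finset.mem_univ k), Function.update_self]
    congr 1
    exact Finset.sum_congr rfl fun i hi => by
      rw [Function.update_of_ne (Finset.ne_of_mem_erase hi)]
  rw [h1]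
  simpa using (hasDerivAt_pow 2 (w k)).add_const (∑ i ∈ Finset.univ.erase k, w i ^ 2)

lemma hasPd_heat (k : Fin d) {τ : ℝ} (hτ : 0 < τ) :
    HasPd k (heat τ) (fun w => weight₁ k τ w * heat τ w) := by
  intro w
  have h := ((((hasPd_normSq k w).neg.div_const (2 * τ)).exp).const_mul
    ((2 * π * τ) ^ (-(d : ℝ) / 2)))
  refine h.congr_deriv ?_
  simp only [Pi.neg_apply, Function.update_eq_self, weight₁, heat, radialHeat]
  field_simp

lemma hasPd_weight₁_mul_heat (k : Fin d) {τ : ℝ} (hτ : 0 < τ) :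
    HasPd k (fun w => weight₁ k τ w * heat τ w) (fun w => weight₂ k τ w * heat τ w) := by
  intro w
  have h1 : HasDerivAt (fun h : ℝ => weight₁ k τ (Function.update w k h)) (-1 / τ) (w k) := by
    simp only [weight₁, Function.update_self]
    exact (hasDerivAt_id (w k)).neg.div_const τ
  refine (h1.mul (hasPd_heat k hτ w)).congr_deriv ?_
  simp only [Function.update_eq_self, weight₁, weight₂]
  field_simp
  ring

variable {g : (Fin d → ℝ) → ℝ} {M : ℝ}

lemma hasPd_heatSg (k : Fin d) {τ : ℝ} (hτ : 0 < τ) (hg : Measurable g) (hM : ∀ x, |g x| ≤ M) :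
    HasPd k (heatSg g τ) (heatInt (weight₁ k τ) g τ) := by
  have h := HasPd.heatInt hτ (φ := fun _ => 1) (φ' := weight₁ k τ)
    (by simpa using hasPd_heat k hτ) measurable_const
    (measurable_weight₁_apply k τ)
    abs_one_le_growth (abs_weight₁_le k hτ) hg hM
  rwa [show heatInt (fun _ => 1) g τ = heatSg g τ from
    funext fun x => heatInt_one_eq_heatSg hτ g x] at h

lemma hasPd_heatInt_weight₁ (k : Fin d) {τ : ℝ} (hτ : 0 < τ) (hg : Measurable g)
    (hM : ∀ x, |g x| ≤ M) :
    HasPd k (heatInt (weight₁ k τ) g τ) (heatInt (weight₂ k τ) g τ) :=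
  HasPd.heatInt hτ (hasPd_weight₁_mul_heat k hτ)
    (measurable_weight₁_apply k τ)
    (measurable_weight₂_apply k τ)
    (abs_weight₁_le k hτ) (abs_weight₂_le k hτ) hg hM

lemma heatInt_weight₂_const (k : Fin d) {τ : ℝ} (hτ : 0 < τ) (c : ℝ) (x : Fin d → ℝ) :
    heatInt (weight₂ k τ) (fun _ => c) τ x = 0 := by
  have hz : HasPd k (fun _ => c) (fun _ : Fin d → ℝ => (0 : ℝ)) := fun x => hasDerivAt_const _ _
  have hz' : HasPd k (fun _ => (0 : ℝ)) (fun _ : Fin d → ℝ => (0 : ℝ)) :=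
    fun x => hasDerivAt_const _ _
  have h1 := hasPd_heatSg (g := fun _ => c) k hτ measurable_const (fun _ => le_rfl)
  have h2 := hasPd_heatInt_weight₁ (g := fun _ => c) k hτ measurable_const (fun _ => le_rfl)
  have h3 : heatSg (fun _ : Fin d → ℝ => c) τ = fun _ => c := by
    funext x
    simp [heatSg, integral_const_mul, integral_heat_one]
  rw [h3] at h1
  rw [h1.unique hz] at h2
  exact congrFun (h2.unique hz') x

/-- The second derivative of the semigroup falls on a twice differentiable function. -/
lemma heatInt_weight₂_eq_heatSg (k : Fin d) {τ : ℝ} (hτ : 0 < τ) {g' g'' : (Fin d → ℝ) → ℝ}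
    (h : HasPd k g g') (h' : HasPd k g' g'') (hg : Measurable g) {M' M'' : ℝ}
    (hM : ∀ x, |g x| ≤ M) (hM' : ∀ x, |g' x| ≤ M') (hM'' : ∀ x, |g'' x| ≤ M'') :
    heatInt (weight₂ k τ) g τ = heatSg g'' τ := by
  have h1 := hasPd_heatSg k hτ hg hM
  have h2 := hasPd_heatInt_weight₁ k hτ hg hM
  rw [h1.unique (h.heatSg hg hM hM' τ)] at h2
  exact h2.unique (h'.heatSg (h.measurable hg) hM' hM'' τ)

lemma exists_abs_heatInt_weight₁_le (hM : ∀ x, |g x| ≤ M) :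
    ∃ C, ∀ (k : Fin d) (τ : ℝ), 0 < τ → ∀ x : Fin d → ℝ,
      |heatInt (weight₁ k τ) g τ x| ≤ C * τ ^ (-(1 / 2) : ℝ) := by
  have hM0 := (abs_nonneg _).trans (hM 0)
  refine ⟨∫ z : Fin d → ℝ, M * ((1 + normSq z) ^ 2 * heat 1 z), fun k τ hτ x => ?_⟩
  rw [heatInt_eq_scaled hτ, ← integral_mul_const, ← Real.norm_eq_abs]
  have hm := measurable_normSq (d := d)
  refine norm_integral_le_of_norm_le (((integrable_mul_heat one_pos (A := 1) (by fun_prop)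
    fun w => ?_).const_mul M).mul_const _) (Eventually.of_forall fun z => ?_)
  · rw [abs_of_nonneg (by positivity), one_mul]
  · have h0 := heat_nonneg one_pos z
    have h1 := abs_weight₁_le k one_pos z
    have h2 : weight₁ k τ (√τ • z) = weight₁ k 1 z * τ ^ (-(1 / 2) : ℝ) := by
      rw [Real.rpow_neg hτ.le, ← Real.sqrt_eq_rpow, weight₁, weight₁, Pi.smul_apply, smul_eq_mul]
      nth_rw 2 [← Real.sq_sqrt hτ.le]
      field_simp
    have h3 : 0 ≤ τ ^ (-(1 / 2) : ℝ) := by positivity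
    rw [h2, norm_mul, norm_mul, norm_mul, Real.norm_of_nonneg h0, Real.norm_of_nonneg h3]
    calc _ ≤ M * ((1 / 1 * (1 + normSq z) ^ 2) * τ ^ (-(1 / 2) : ℝ) * heat 1 z) := by
          gcongr
          · exact hM _
          · exact h1
      _ = _ := by ring

/-- The second derivatives of the semigroup of a bounded Hölder function. -/
lemma exists_abs_heatInt_weight₂_le (hg : Measurable g) (hM : ∀ x, |g x| ≤ M) {α : ℝ} (hα₁ : 0 < α)
    (hα₂ : α ≤ 1) {H : ℝ} (hH : ∀ x y, |g x - g y| ≤ H * dist x y ^ α) :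
    ∃ C, ∀ (k : Fin d) (τ : ℝ), 0 < τ → ∀ x : Fin d → ℝ,
      |heatInt (weight₂ k τ) g τ x| ≤ C * τ ^ (α / 2 - 1) := by
  refine ⟨∫ z : Fin d → ℝ, |H| * 2 * ((1 + normSq z) * (1 + normSq z) * heat 1 z),
    fun k τ hτ x => ?_⟩
  have hm := measurable_normSq (d := d)
  have h0 : heatInt (weight₂ k τ) g τ x = heatInt (weight₂ k τ) (fun y => g y - g x) τ x := by
    have hw := measurable_weight₂_apply k τ
    have := integral_sub (integrable_mul_mul_heat hτ hw (abs_weight₂_le k hτ) hg hM x)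
      (integrable_mul_mul_heat hτ hw (abs_weight₂_le k hτ) (g := fun _ => g x) measurable_const
        (fun _ => le_rfl) x)
    have hc := heatInt_weight₂_const k hτ (g x) x
    simp only [heatInt] at hc ⊢
    simp only [sub_mul]
    erw [this, hc, sub_zero]
  rw [h0, heatInt_eq_scaled hτ, ← integral_mul_const, ← Real.norm_eq_abs]
  refine norm_integral_le_of_norm_le (((integrable_mul_heat one_pos (A := 1) (by fun_prop)
    fun w => ?_).const_mul _).mul_const _) (Eventually.of_forall fun z => ?_)
  · rw [abs_of_nonneg (by have := normSq_nonneg w; positivity), one_mul, sq]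
  · have hz := heat_nonneg one_pos z
    have hn := normSq_nonneg z
    have h1 : |weight₂ k 1 z| ≤ 2 * (1 + normSq z) := by
      have := sq_le_normSq z k
      rw [weight₂, abs_le]
      constructor <;> norm_num <;> nlinarith [sq_nonneg (z k)]
    have h2 : weight₂ k τ (√τ • z) = weight₂ k 1 z * τ⁻¹ := by
      rw [weight₂, weight₂, Pi.smul_apply, smul_eq_mul, mul_pow, Real.sq_sqrt hτ.le]
      field_simp
    have h3 : |g (x - √τ • z) - g x| ≤ |H| * (τ ^ (α / 2) * (1 + normSq z)) := by
      refine (hH _ _).trans ?_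
      have e1 : dist (x - √τ • z) x = √τ * ‖z‖ := by
        rw [dist_eq_norm, sub_sub_cancel_left, norm_neg, norm_smul, Real.norm_of_nonneg
          (Real.sqrt_nonneg _)]
      have e2 : ‖z‖ ^ α ≤ 1 + normSq z := by
        have hsq := norm_sq_le_normSq z
        rcases le_total ‖z‖ 1 with hz1 | hz1
        · have := Real.rpow_le_one (norm_nonneg z) hz1 hα₁.le
          linarith
        · have := Real.rpow_le_rpow_of_exponent_le hz1 hα₂
          rw [Real.rpow_one] at this
          nlinarith
      rw [e1, Real.mul_rpow (Real.sqrt_nonneg _) (norm_nonneg _), Real.sqrt_eq_rpow,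
        ← Real.rpow_mul hτ.le, show 1 / 2 * α = α / 2 by ring]
      gcongr
      exact le_abs_self H
    have h4 : τ ^ (α / 2 - 1) = τ ^ (α / 2) * τ⁻¹ := by
      rw [Real.rpow_sub_one hτ.ne', div_eq_mul_inv]
    rw [h2, h4, norm_mul, norm_mul, norm_mul, Real.norm_of_nonneg hz,
      Real.norm_of_nonneg (inv_nonneg.2 hτ.le)]
    calc _ ≤ (|H| * (τ ^ (α / 2) * (1 + normSq z))) *
          ((2 * (1 + normSq z)) * τ⁻¹ * heat 1 z) := by
          gcongr
          · exact h3
          · exact h1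
      _ = _ := by ring

/-- The semigroup solves the heat equation. -/
lemma hasDerivAt_heatSg (hg : Measurable g) (hM : ∀ x, |g x| ≤ M) {τ₀ : ℝ} (hτ₀ : 0 < τ₀)
    (x : Fin d → ℝ) :
    HasDerivAt (fun τ => heatSg g τ x)
      ((1 / 2) * ∑ k, heatInt (weight₂ k τ₀) g τ₀ x) τ₀ := by
  obtain ⟨C, hC, hCb⟩ := exists_abs_deriv_radialHeat_le d hτ₀ d.cast_nonneg
  have hM0 := (abs_nonneg _).trans (hM 0)
  have meas : ∀ τ, AEStronglyMeasurable (fun y => g y * heat τ (x - y)) volume := fun τ =>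
    (hg.mul ((measurable_heat.comp (measurable_const.prodMk
      (measurable_const.sub measurable_id))))).aestronglyMeasurable
  have hint := fun k => integrable_mul_mul_heat hτ₀ (measurable_weight₂_apply k τ₀)
    (abs_weight₂_le k hτ₀) hg hM x
  have hsum : ∀ y, g y * ((1 / 2) * (normSq (x - y) / τ₀ ^ 2 - d / τ₀) * heat τ₀ (x - y)) =
      (1 / 2) * ∑ k, g y * (weight₂ k τ₀ (x - y) * heat τ₀ (x - y)) := by
    intro y
    rw [← Finset.mul_sum, ← Finset.sum_mul]
    simp only [weight₂, Finset.sum_sub_distrib, ← Finset.sum_div, Finset.sum_const,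
      Finset.card_univ, Fintype.card_fin, nsmul_eq_mul, normSq]
    ring
  have key := (hasDerivAt_integral_of_dominated_loc_of_deriv_le (μ := volume) (x₀ := τ₀)
    (F := fun τ y => g y * heat τ (x - y))
    (F' := fun τ y => g y * ((1 / 2) * (normSq (x - y) / τ ^ 2 - d / τ) * heat τ (x - y)))
    (bound := fun y => M * (C * Real.exp (-(1 / (6 * τ₀)) * normSq (x - y))))
    (Metric.ball_mem_nhds _ (half_pos hτ₀)) (Eventually.of_forall meas)
    (by simpa using integrable_mul_mul_heat hτ₀ measurable_const abs_one_le_growth hg hM x)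
    (by
      simp only [hsum]
      exact (Finset.aestronglyMeasurable_fun_sum _
        fun k _ => (hint k).aestronglyMeasurable).const_mul _)
    (Eventually.of_forall fun y τ hτ => by
      rw [norm_mul]
      exact mul_le_mul (hM y) (hCb τ _ (by simpa [Real.dist_eq] using hτ) (normSq_nonneg _))
        (norm_nonneg _) hM0)
    ((((integrable_exp_neg_mul_normSq (by positivity)).comp_sub_left x).const_mul C).const_mul M)
    (Eventually.of_forall fun y τ hτ => by
      have h1 := (abs_lt.1 (by simpa [Real.dist_eq] using hτ : |τ - τ₀| < τ₀ / 2)).1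
      exact (hasDerivAt_radialHeat d (normSq (x - y)) (by linarith : 0 < τ)).const_mul (g y))).2
  simp only [hsum, integral_const_mul] at key
  rw [integral_finsetSum _ fun k _ => hint k] at key
  refine key.congr_of_eventuallyEq ?_
  filter_upwards [lt_mem_nhds hτ₀] with τ hτ
  rw [← heatInt_one_eq_heatSg hτ]
  simp [heatInt]

end HeatKernel

lemma Kbm_nonneg {t : ℝ} (ht : 0 < t) (s : ℝ) : 0 ≤ Kbm t s := by
  unfold Kbm; positivity

lemma Kbm_eq {t : ℝ} (s : ℝ) :
    Kbm t s = (2 * π * t) ^ (-(1 : ℝ) / 2) * Real.exp (-(1 / (2 * t)) * s ^ 2) := by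
  rw [Kbm]; congr 2; ring

lemma Kbm_eq_radialHeat (t s : ℝ) : Kbm t s = radialHeat 1 t (s ^ 2) := rfl

lemma continuous_Kbm (t : ℝ) : Continuous (Kbm t) := by
  unfold Kbm; fun_prop

lemma hasDerivAt_Kbm (t s : ℝ) : HasDerivAt (Kbm t) (-s / t * Kbm t s) s := by
  have h := ((((hasDerivAt_pow 2 s).neg.div_const (2 * t)).exp).const_mul
    ((2 * π * t) ^ (-(1 : ℝ) / 2)))
  refine h.congr_deriv ?_
  simp only [Kbm, Pi.neg_apply]
  rcases eq_or_ne t 0 with rfl | ht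
  · simp
  · field_simp
    push_cast
    ring

lemma hasDerivAt_mul_Kbm (t s : ℝ) :
    HasDerivAt (fun s => -s / t * Kbm t s) ((s ^ 2 / t ^ 2 - 1 / t) * Kbm t s) s := by
  refine (((hasDerivAt_id s).neg.div_const t).mul (hasDerivAt_Kbm t s)).congr_deriv ?_
  simp only [Pi.neg_apply, id]
  ring

lemma integrableOn_rpow_mul_Kbm {t p : ℝ} (ht : 0 < t) (hp : -1 < p) :
    IntegrableOn (fun s => s ^ p * Kbm t s) (Set.Ioi 0) := by
  have := (integrableOn_rpow_mul_exp_neg_mul_sq (b := 1 / (2 * t)) (by positivity) hp).const_mul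
    ((2 * π * t) ^ (-(1 : ℝ) / 2))
  refine this.congr (Eventually.of_forall fun s => ?_)
  simp only [Kbm_eq]; ring

lemma tendsto_pow_mul_Kbm {t : ℝ} (ht : 0 < t) (p : ℕ) :
    Tendsto (fun s => s ^ p * Kbm t s) atTop (nhds 0) := by
  have h := ((tendsto_rpow_abs_mul_exp_neg_mul_sq_cocompact (a := 1 / (2 * t)) (by positivity)
    p).mono_left atTop_le_cocompact).mul_const ((2 * π * t) ^ (-(1 : ℝ) / 2))
  rw [zero_mul] at h
  refine h.congr' ?_
  filter_upwards [eventually_ge_atTop 0] with s hs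
  rw [abs_of_nonneg hs, Real.rpow_natCast, Kbm_eq]
  ring

lemma integral_Ioi_mul_Kbm {t : ℝ} (ht : 0 < t) :
    ∫ s in Set.Ioi 0, s * Kbm t s = √(t / (2 * π)) := by
  have hint : IntegrableOn (fun s => s * Kbm t s) (Set.Ioi 0) := by
    simpa using integrableOn_rpow_mul_Kbm (p := 1) ht (by norm_num)
  have h := integral_Ioi_of_hasDerivAt_of_tendsto (f := fun s => -t * Kbm t s)
    (f' := fun s => s * Kbm t s) (a := 0) (m := 0)
    ((continuous_const.mul (continuous_Kbm t)).continuousWithinAt)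
    (fun s _ => ((hasDerivAt_Kbm t s).const_mul (-t)).congr_deriv (by field_simp)) hint
    (by simpa using (tendsto_pow_mul_Kbm ht 0).const_mul (-t))
  rw [h, Kbm]
  simp only [ne_eq, OfNat.ofNat_ne_zero, not_false_eq_true, zero_pow, neg_zero, zero_div,
    Real.exp_zero, mul_one, zero_sub, neg_mul, neg_neg]
  rw [neg_div, Real.rpow_neg (by positivity), ← Real.sqrt_eq_rpow, Real.sqrt_mul (by positivity),
    Real.sqrt_div ht.le]
  nth_rw 1 [← Real.sq_sqrt ht.le]
  field_simp

/-- Integration by parts on a half-line against the second space derivative of the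
one-dimensional heat kernel. -/
lemma integral_Ioi_comp_mul_deriv_Kbm {G G' G'' : ℝ → ℝ} {a t A B C β : ℝ} (ha : 0 < a)
    (ht : 0 < t) (hGc : Continuous G) (hGc' : Continuous G')
    (hG : ∀ τ, 0 < τ → HasDerivAt G (G' τ) τ) (hG' : ∀ τ, 0 < τ → HasDerivAt G' (G'' τ) τ)
    (hA : ∀ τ, |G τ| ≤ A) (hB : ∀ τ, |G' τ| ≤ B) (hβ : -1 < β)
    (hC : ∀ τ, 0 < τ → |G'' τ| ≤ C * τ ^ β) (hm : Measurable G'') :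
    ∫ s in Set.Ioi 0, G (s * a) * ((1 / 2) * (s ^ 2 / t ^ 2 - 1 / t) * Kbm t s) =
      (1 / 2) * G' 0 * Kbm t 0 * a +
        (1 / 2) * ∫ s in Set.Ioi 0, a ^ 2 * G'' (s * a) * Kbm t s := by
  have hKm := (continuous_Kbm t).measurable
  have hi1 : IntegrableOn (fun s => G (s * a) * ((s ^ 2 / t ^ 2 - 1 / t) * Kbm t s))
      (Set.Ioi 0) := by
    refine Integrable.bdd_mul (c := A) ?_ (hGc.comp (by fun_prop)).aestronglyMeasurable
      (Eventually.of_forall fun s => hA _)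
    have e2 := integrableOn_rpow_mul_Kbm (p := 2) ht (by norm_num)
    have e0 := integrableOn_rpow_mul_Kbm (p := 0) ht (by norm_num)
    refine ((e2.const_mul (1 / t ^ 2)).sub (e0.const_mul (1 / t))).congr
      (Eventually.of_forall fun s => ?_)
    simp only [Pi.sub_apply, Real.rpow_two, Real.rpow_zero]
    ring
  have hi2 : IntegrableOn (fun s => a ^ 2 * G'' (s * a) * Kbm t s) (Set.Ioi 0) := by
    refine ((integrableOn_rpow_mul_Kbm ht hβ).const_mul (a ^ 2 * (C * a ^ β))).mono' ?_ ?_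
    · exact (((hm.comp (by fun_prop)).const_mul _).mul hKm).aestronglyMeasurable
    · filter_upwards [ae_restrict_mem measurableSet_Ioi] with s hs
      have hs : 0 < s := hs
      rw [norm_mul, norm_mul, Real.norm_of_nonneg (Kbm_nonneg ht s), Real.norm_of_nonneg
        (sq_nonneg a), Real.norm_eq_abs]
      have := hC (s * a) (by positivity)
      rw [Real.mul_rpow hs.le ha.le] at this
      have h0 := Kbm_nonneg ht s
      calc _ ≤ a ^ 2 * (C * (s ^ β * a ^ β)) * Kbm t s := by gcongr
        _ = _ := by ring
  have h := integral_Ioi_of_hasDerivAt_of_tendsto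
    (f := fun s => G (s * a) * (-s / t * Kbm t s) - a * G' (s * a) * Kbm t s)
    (f' := fun s => G (s * a) * ((s ^ 2 / t ^ 2 - 1 / t) * Kbm t s) -
      a ^ 2 * G'' (s * a) * Kbm t s) (a := 0) (m := 0)
    (by
      have := continuous_Kbm t
      exact Continuous.continuousWithinAt (by fun_prop))
    (fun s hs => by
      have hs : 0 < s := hs
      have hsa : HasDerivAt (fun s => s * a) (1 * a) s := (hasDerivAt_id s).mul_const a
      have d1 := (hG (s * a) (by positivity)).comp s hsa
      have d2 := (hG' (s * a) (by positivity)).comp s hsa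
      refine ((d1.mul (hasDerivAt_mul_Kbm t s)).sub
        ((d2.const_mul a).mul (hasDerivAt_Kbm t s))).congr_deriv ?_
      simp only [Function.comp_apply]
      ring)
    (hi1.sub hi2)
    (by
      have l1 : Tendsto (fun s => -s / t * Kbm t s) atTop (nhds 0) := by
        have := (tendsto_pow_mul_Kbm ht 1).const_mul (-1 / t)
        rw [mul_zero] at this
        exact this.congr fun s => by ring
      have l2 : Tendsto (Kbm t) atTop (nhds 0) := by simpa using tendsto_pow_mul_Kbm ht 0
      have m1 := bdd_le_mul_tendsto_zero' A (Eventually.of_forall fun s => hA (s * a)) l1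
      have m2 := (bdd_le_mul_tendsto_zero' B (Eventually.of_forall fun s => hB (s * a)) l2).const_mul
        a
      simpa [mul_assoc] using m1.sub m2)
  rw [integral_sub hi1 hi2] at h
  simp only [zero_mul, neg_zero, zero_div, mul_zero, zero_sub, sub_neg_eq_add, sub_eq_iff_eq_add]
    at h
  have e : ∀ s, G (s * a) * ((1 / 2) * (s ^ 2 / t ^ 2 - 1 / t) * Kbm t s) =
      (1 / 2) * (G (s * a) * ((s ^ 2 / t ^ 2 - 1 / t) * Kbm t s)) := fun s => by ring
  simp only [e, integral_const_mul, h]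
  ring

/-- Lebesgue measure on the positive half-line. -/
abbrev posVolume : Measure ℝ := volume.restrict (Set.Ioi 0)

/-- Lebesgue measure on the positive orthant, with one coordinate split off. -/
abbrev orthantVolume (m : ℕ) : Measure (ℝ × (Fin m → ℝ)) :=
  posVolume.prod (Measure.pi fun _ => posVolume)

lemma ae_orthantVolume (m : ℕ) : ∀ᵐ q ∂orthantVolume m, 0 < q.1 ∧ ∀ i, 0 < q.2 i := by
  rw [orthantVolume, ← Measure.restrict_pi_pi, Measure.prod_restrict]
  filter_upwards [ae_restrict_mem
    (measurableSet_Ioi.prod (MeasurableSet.univ_pi fun _ => measurableSet_Ioi))] with q hq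
  exact ⟨hq.1, fun i => hq.2 i (Set.mem_univ i)⟩

lemma setIntegral_pos_eq_orthantVolume {m : ℕ} (j : Fin (m + 1)) (F : ℝ → (Fin m → ℝ) → ℝ) :
    ∫ s in {s : Fin (m + 1) → ℝ | ∀ i, 0 < s i}, F (s j) (fun i => s (j.succAbove i)) =
      ∫ q, F q.1 q.2 ∂orthantVolume m := by
  have h1 : {s : Fin (m + 1) → ℝ | ∀ i, 0 < s i} = Set.univ.pi fun _ => Set.Ioi 0 := by
    ext s; simp
  rw [h1, volume_pi, Measure.restrict_pi_pi]
  exact (measurePreserving_piFinSuccAbove (fun _ : Fin (m + 1) => posVolume) j).integral_comp'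
    (fun q => F q.1 q.2)

lemma integrable_rpow_mul_Kbm {m : ℕ} {t p : ℝ} (ht : 0 < t) {T : Fin m → ℝ} (hT : ∀ i, 0 < T i)
    (hp : -1 < p) :
    Integrable (fun q : ℝ × (Fin m → ℝ) => (q.1 * ∏ i, q.2 i) ^ p *
      ((∏ i, q.2 i) ^ 2 * (Kbm t q.1 * ∏ i, Kbm (T i) (q.2 i)))) (orthantVolume m) := by
  have h1 : Integrable (fun s => s ^ p * Kbm t s) posVolume := integrableOn_rpow_mul_Kbm ht hp
  have h2 := Integrable.fintype_prod (ι := Fin m) (f := fun i s => s ^ (p + 2) * Kbm (T i) s)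
    (μ := fun _ => posVolume) (fun i => integrableOn_rpow_mul_Kbm (hT i) (by linarith))
  refine (h1.mul_prod h2).congr ?_
  filter_upwards [ae_orthantVolume m] with q hq
  have h3 : ∏ i, q.2 i ^ (p + 2) = (∏ i, q.2 i) ^ p * (∏ i, q.2 i) ^ 2 := by
    rw [← Real.finsetProd_rpow _ _ fun i _ => (hq.2 i).le, ← Finset.prod_pow,
      ← Finset.prod_mul_distrib]
    exact Finset.prod_congr rfl fun i _ => by
      rw [Real.rpow_add (hq.2 i), Real.rpow_two]
  rw [Finset.prod_mul_distrib, h3, Real.mul_rpow hq.1.le (Finset.prod_nonneg fun i _ => (hq.2 i).le)]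
  ring

section SpaceDerivatives

variable {d : ℕ} {Ω : Type*} [MeasurableSpace Ω] {μ : Measure Ω} {W σ : Ω → ℝ}
  {g : (Fin d → ℝ) → ℝ} {M : ℝ}

lemma integrable_mul_heatSg (hW : Integrable W μ) (hσ : Measurable σ) (hg : Measurable g)
    (hM : ∀ x, |g x| ≤ M) (x : Fin d → ℝ) :
    Integrable (fun ω => W ω * heatSg g (σ ω) x) μ :=
  hW.mul_bdd ((measurable_heatSg hg x).comp hσ).aestronglyMeasurable
    (Eventually.of_forall fun _ => abs_heatSg_le hM _ x)

lemma hasPd_integral_mul_heatSg (hW : Integrable W μ) (hσ : Measurable σ) {k : Fin d}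
    {g' : (Fin d → ℝ) → ℝ} (h : HasPd k g g') (hg : Measurable g) {M' : ℝ}
    (hM : ∀ x, |g x| ≤ M) (hM' : ∀ x, |g' x| ≤ M') :
    HasPd k (fun x => ∫ ω, W ω * heatSg g (σ ω) x ∂μ)
      (fun x => ∫ ω, W ω * heatSg g' (σ ω) x ∂μ) := by
  refine HasPd.integral (Eventually.of_forall fun ω => (h.heatSg hg hM hM' (σ ω)).const_mul (W ω))
    (fun x => (integrable_mul_heatSg hW hσ hg hM x).aestronglyMeasurable)
    (fun x => (integrable_mul_heatSg hW hσ (h.measurable hg) hM' x).aestronglyMeasurable)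
    (integrable_mul_heatSg hW hσ hg hM) (fun x => ?_)
  refine ⟨fun ω => ‖W ω‖ * M', hW.norm.mul_const _, Eventually.of_forall fun ω t _ => ?_⟩
  rw [abs_mul]
  exact mul_le_mul_of_nonneg_left (abs_heatSg_le hM' _ _) (abs_nonneg _)

lemma integrable_mul_heatInt {φ : ℝ → (Fin d → ℝ) → ℝ} (hφ : Measurable (Function.uncurry φ))
    (hW : AEStronglyMeasurable W μ) (hσ : Measurable σ) (hpos : ∀ᵐ ω ∂μ, 0 < σ ω)
    (hg : Measurable g) {C p : ℝ} (hWp : Integrable (fun ω => σ ω ^ p * W ω) μ)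
    (hC : ∀ τ, 0 < τ → ∀ x, |heatInt (φ τ) g τ x| ≤ C * τ ^ p) (x : Fin d → ℝ) :
    Integrable (fun ω => W ω * heatInt (φ (σ ω)) g (σ ω) x) μ := by
  refine (hWp.norm.const_mul C).mono'
    (hW.mul ((measurable_heatInt hφ hg x).comp hσ).aestronglyMeasurable) ?_
  filter_upwards [hpos] with ω hω
  rw [norm_mul, norm_mul, Real.norm_of_nonneg (Real.rpow_nonneg hω.le p)]
  calc _ ≤ ‖W ω‖ * (C * σ ω ^ p) := mul_le_mul_of_nonneg_left (hC _ hω x) (norm_nonneg _)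
    _ = _ := by ring

lemma hasPd_integral_mul_heat {φ' : ℝ → (Fin d → ℝ) → ℝ}
    (hφ' : Measurable (Function.uncurry φ')) {Φ : ℝ → (Fin d → ℝ) → ℝ}
    (hW : AEStronglyMeasurable W μ) (hσ : Measurable σ) (hpos : ∀ᵐ ω ∂μ, 0 < σ ω)
    (hg : Measurable g) {C p : ℝ} (hWp : Integrable (fun ω => σ ω ^ p * W ω) μ) {k : Fin d}
    (hC : ∀ τ, 0 < τ → ∀ x, |heatInt (φ' τ) g τ x| ≤ C * τ ^ p)
    (hint : ∀ x, Integrable (fun ω => W ω * Φ (σ ω) x) μ)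
    (h : ∀ τ, 0 < τ → HasPd k (Φ τ) (heatInt (φ' τ) g τ)) :
    HasPd k (fun x => ∫ ω, W ω * Φ (σ ω) x ∂μ)
      (fun x => ∫ ω, W ω * heatInt (φ' (σ ω)) g (σ ω) x ∂μ) := by
  refine HasPd.integral (by filter_upwards [hpos] with ω hω using (h _ hω).const_mul (W ω))
    (fun x => (hint x).aestronglyMeasurable)
    (fun x => (integrable_mul_heatInt hφ' hW hσ hpos hg hWp hC x).aestronglyMeasurable)
    hint (fun x => ?_)
  refine ⟨_, hWp.norm.const_mul C, ?_⟩
  filter_upwards [hpos] with ω hω t _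
  rw [abs_mul, norm_mul, Real.norm_of_nonneg (Real.rpow_nonneg hω.le p)]
  calc _ ≤ |W ω| * (C * σ ω ^ p) := mul_le_mul_of_nonneg_left (hC _ hω _) (abs_nonneg _)
    _ = _ := by rw [Real.norm_eq_abs]; ring

/-- The Laplacian of a time average of the semigroup, when it falls on the function. -/
lemma lap_integral_mul_heatSg (hW : Integrable W μ) (hσ : Measurable σ) (hg : Measurable g)
    {g' g'' : Fin d → (Fin d → ℝ) → ℝ} (h : ∀ k, HasPd k g (g' k))
    (h' : ∀ k, HasPd k (g' k) (g'' k)) {M' M'' : ℝ}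
    (hM : ∀ x, |g x| ≤ M) (hM' : ∀ k x, |g' k x| ≤ M') (hM'' : ∀ k x, |g'' k x| ≤ M'') :
    lap (fun x => ∫ ω, W ω * heatSg g (σ ω) x ∂μ) =
      fun x => ∫ ω, W ω * heatSg (fun y => ∑ k, g'' k y) (σ ω) x ∂μ := by
  have hm'' : ∀ k, Measurable (g'' k) := fun k => (h' k).measurable ((h k).measurable hg)
  rw [lap_eq_of_hasPd (fun k => hasPd_integral_mul_heatSg hW hσ (h k) hg hM (hM' k))
    (fun k => hasPd_integral_mul_heatSg hW hσ (h' k) ((h k).measurable hg) (hM' k) (hM'' k))]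
  funext x
  rw [← integral_finsetSum _ fun k _ => integrable_mul_heatSg hW hσ (hm'' k) (hM'' k) x]
  congr 1
  funext ω
  rw [← Finset.mul_sum]
  congr 1
  simp only [heatSg, Finset.sum_mul]
  rw [integral_finsetSum]
  intro k _
  exact ((integrable_heat one_pos).const_mul M'').mono'
    (((hm'' k).comp (by fun_prop)).mul measurable_heat_one).aestronglyMeasurable
    (Eventually.of_forall fun z => norm_mul_heat_le (hM'' k _) z)

/-- The Laplacian of a time average of the semigroup, when it falls on the kernel. -/
lemma lap_integral_mul_heatSg_of_holder (hW : Integrable W μ) (hσ : Measurable σ)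
    (hpos : ∀ᵐ ω ∂μ, 0 < σ ω) (hg : Measurable g) (hM : ∀ x, |g x| ≤ M) {α : ℝ} (hα₁ : 0 < α)
    (hα₂ : α ≤ 1) {H : ℝ} (hH : ∀ x y, |g x - g y| ≤ H * dist x y ^ α)
    (hW₁ : Integrable (fun ω => σ ω ^ (-(1 / 2) : ℝ) * W ω) μ)
    (hW₂ : Integrable (fun ω => σ ω ^ (α / 2 - 1) * W ω) μ) :
    lap (fun x => ∫ ω, W ω * heatSg g (σ ω) x ∂μ) =
      fun x => ∫ ω, W ω * ∑ k, heatInt (weight₂ k (σ ω)) g (σ ω) x ∂μ := by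
  obtain ⟨C₁, hC₁⟩ := exists_abs_heatInt_weight₁_le hM
  obtain ⟨C₂, hC₂⟩ := exists_abs_heatInt_weight₂_le hg hM hα₁ hα₂ hH
  have hWm := hW.aestronglyMeasurable
  have hint := fun k => integrable_mul_heatInt (measurable_weight₂ k) hWm hσ hpos hg hW₂ (hC₂ k)
  rw [lap_eq_of_hasPd
    (fun k => hasPd_integral_mul_heat (measurable_weight₁ k) hWm hσ hpos hg hW₁ (hC₁ k)
      (integrable_mul_heatSg hW hσ hg hM) fun τ hτ => hasPd_heatSg k hτ hg hM)
    (fun k => hasPd_integral_mul_heat (measurable_weight₂ k) hWm hσ hpos hg hW₂ (hC₂ k)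
      (integrable_mul_heatInt (measurable_weight₁ k) hWm hσ hpos hg hW₁ (hC₁ k))
      fun τ hτ => hasPd_heatInt_weight₁ k hτ hg hM)]
  funext x
  rw [← integral_finsetSum _ fun k _ => hint k x]
  simp only [Finset.mul_sum]

end SpaceDerivatives

lemma HasPd.abs_update_sub_le {d : ℕ} {k : Fin d} {F F' : (Fin d → ℝ) → ℝ} {B : ℝ}
    (h : HasPd k F F') (hB : ∀ x, |F' x| ≤ B) (x : Fin d → ℝ) (a : ℝ) :
    |F (Function.update x k a) - F x| ≤ B * |a - x k| := by
  have := (convex_univ : Convex ℝ (Set.univ : Set ℝ)).norm_image_sub_le_of_norm_hasDerivWithin_le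
    (fun t _ => (h.hasDerivAt x t).hasDerivWithinAt) (fun t _ => hB (Function.update x k t))
    (Set.mem_univ (x k)) (Set.mem_univ a)
  simpa using this

/-- A function with bounded partial derivatives is continuous. -/
lemma continuous_of_hasPd {d : ℕ} {F : (Fin d → ℝ) → ℝ} {F' : Fin d → (Fin d → ℝ) → ℝ} {B : ℝ}
    (h : ∀ k, HasPd k F (F' k)) (hB : ∀ k x, |F' k x| ≤ B) : Continuous F := by
  have key : ∀ (s : Finset (Fin d)) (x y : Fin d → ℝ),
      |F (s.piecewise y x) - F x| ≤ ∑ k ∈ s, B * |y k - x k| := by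
    intro s x y
    induction s using Finset.induction_on with
    | empty => simp
    | insert k s hk ih =>
      rw [Finset.piecewise_insert, Finset.sum_insert hk]
      have h1 := (h k).abs_update_sub_le (hB k) (s.piecewise y x) (y k)
      rw [Finset.piecewise_eq_of_notMem _ _ _ hk] at h1
      exact (abs_sub_le _ (F (s.piecewise y x)) _).trans (add_le_add h1 ih)
  rw [continuous_iff_continuousAt]
  intro x
  rw [ContinuousAt, tendsto_iff_norm_sub_tendsto_zero]
  refine squeeze_zero (fun _ => norm_nonneg _)
    (fun y => by simpa using key Finset.univ x y) ?_
  have : Continuous fun y : Fin d → ℝ => ∑ k, B * |y k - x k| := by fun_prop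
  simpa using this.tendsto x

lemma continuous_of_holder {d : ℕ} {F : (Fin d → ℝ) → ℝ} {H α : ℝ} (hα : 0 < α)
    (hH : ∀ x y, |F x - F y| ≤ H * dist x y ^ α) : Continuous F := by
  rw [continuous_iff_continuousAt]
  intro x
  rw [ContinuousAt, tendsto_iff_norm_sub_tendsto_zero]
  refine squeeze_zero (fun _ => norm_nonneg _) (fun y => hH y x) ?_
  have : Continuous fun y : Fin d → ℝ => H * dist y x ^ α :=
    ((continuous_id.dist continuous_const).rpow_const fun _ => Or.inr hα.le).const_mul H
  simpa [Real.zero_rpow hα.ne'] using this.tendsto x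

lemma integrable_prod_Kbm {m : ℕ} {T : Fin m → ℝ} (hT : ∀ i, 0 < T i) :
    Integrable (fun s : Fin m → ℝ => ∏ i, Kbm (T i) (s i)) (Measure.pi fun _ => posVolume) :=
  Integrable.fintype_prod (ι := Fin m) (f := fun i s => Kbm (T i) s) (μ := fun _ => posVolume)
    fun i => by simpa [IntegrableOn] using integrableOn_rpow_mul_Kbm (hT i) (p := 0) (by norm_num)

lemma measurable_prod_Kbm {m : ℕ} (T : Fin m → ℝ) :
    Measurable fun s : Fin m → ℝ => ∏ i, Kbm (T i) (s i) :=
  Finset.measurable_prod _ fun i _ => (continuous_Kbm (T i)).measurable.comp (measurable_pi_apply i)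

lemma hasDerivAt_integral_mul_Kbm {m : ℕ} {G : ℝ → ℝ} {A t : ℝ} (ht : 0 < t) {T : Fin m → ℝ}
    (hT : ∀ i, 0 < T i) (hG : Measurable G) (hA : ∀ τ, |G τ| ≤ A) :
    Integrable (fun q : ℝ × (Fin m → ℝ) => G (q.1 * ∏ i, q.2 i) *
      ((1 / 2) * (q.1 ^ 2 / t ^ 2 - 1 / t) * Kbm t q.1 * ∏ i, Kbm (T i) (q.2 i)))
      (orthantVolume m) ∧
    HasDerivAt (fun h => ∫ q, G (q.1 * ∏ i, q.2 i) * (Kbm h q.1 * ∏ i, Kbm (T i) (q.2 i))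
        ∂orthantVolume m)
      (∫ q, G (q.1 * ∏ i, q.2 i) * ((1 / 2) * (q.1 ^ 2 / t ^ 2 - 1 / t) * Kbm t q.1 *
        ∏ i, Kbm (T i) (q.2 i)) ∂orthantVolume m) t := by
  obtain ⟨C, hC, hCb⟩ := exists_abs_deriv_radialHeat_le 1 ht zero_le_one
  have hGm : Measurable fun q : ℝ × (Fin m → ℝ) => G (q.1 * ∏ i, q.2 i) :=
    hG.comp (by fun_prop)
  have hκm : Measurable fun q : ℝ × (Fin m → ℝ) => ∏ i, Kbm (T i) (q.2 i) :=
    (measurable_prod_Kbm T).comp measurable_snd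
  have hKm : ∀ h, Measurable fun q : ℝ × (Fin m → ℝ) => Kbm h q.1 := fun h =>
    (continuous_Kbm h).measurable.comp measurable_fst
  have hκ0 : ∀ᵐ q ∂orthantVolume m, 0 ≤ ∏ i, Kbm (T i) (q.2 i) :=
    Eventually.of_forall fun q => Finset.prod_nonneg fun i _ => Kbm_nonneg (hT i) _
  have hK : Integrable (Kbm t) posVolume := by
    simpa [IntegrableOn] using integrableOn_rpow_mul_Kbm ht (p := 0) (by norm_num)
  have hbd : Integrable (fun q : ℝ × (Fin m → ℝ) => A * C *
      (Real.exp (-(1 / (6 * t)) * q.1 ^ 2) * ∏ i, Kbm (T i) (q.2 i))) (orthantVolume m) :=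
    (((integrable_exp_neg_mul_sq (by positivity)).integrableOn).mul_prod
      (integrable_prod_Kbm hT)).const_mul _
  refine hasDerivAt_integral_of_dominated_loc_of_deriv_le
    (F' := fun h q => G (q.1 * ∏ i, q.2 i) * ((1 / 2) * (q.1 ^ 2 / h ^ 2 - 1 / h) * Kbm h q.1 *
        ∏ i, Kbm (T i) (q.2 i)))
    (Metric.ball_mem_nhds t (half_pos ht))
    (Eventually.of_forall fun h => (hGm.mul ((hKm h).mul hκm)).aestronglyMeasurable)
    ((hK.mul_prod (integrable_prod_Kbm hT)).bdd_mul hGm.aestronglyMeasurable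
      (Eventually.of_forall fun _ => hA _))
    (hGm.mul ((Measurable.mul (by fun_prop) (hKm t)).mul hκm)).aestronglyMeasurable
    ?_ hbd (Eventually.of_forall fun q h hh => ?_)
  · filter_upwards [hκ0] with q hq h hh
    rw [Metric.mem_ball, Real.dist_eq] at hh
    rw [norm_mul, norm_mul, Real.norm_of_nonneg hq]
    have h1 := hCb h (q.1 ^ 2) hh (sq_nonneg _)
    rw [← Kbm_eq_radialHeat] at h1
    calc _ ≤ A * (C * Real.exp (-(1 / (6 * t)) * q.1 ^ 2) * ∏ i, Kbm (T i) (q.2 i)) :=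
          mul_le_mul (hA _) (mul_le_mul_of_nonneg_right h1 hq) (by positivity)
            ((abs_nonneg _).trans (hA 0))
      _ = _ := by ring
  · rw [Metric.mem_ball, Real.dist_eq] at hh
    have hh0 : 0 < h := by linarith [(abs_lt.1 hh).1]
    exact ((hasDerivAt_radialHeat 1 (q.1 ^ 2) hh0).mul_const _).const_mul _

/-- The time derivative of an average over the positive orthant, computed by integrating by parts
twice in the coordinate whose kernel is differentiated. -/
lemma hasDerivAt_orthant_average {m : ℕ} {G G' G'' : ℝ → ℝ} {t A B C β : ℝ} (ht : 0 < t)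
    {T : Fin m → ℝ} (hT : ∀ i, 0 < T i) (hGc : Continuous G) (hGc' : Continuous G')
    (hG : ∀ τ, 0 < τ → HasDerivAt G (G' τ) τ) (hG' : ∀ τ, 0 < τ → HasDerivAt G' (G'' τ) τ)
    (hA : ∀ τ, |G τ| ≤ A) (hB : ∀ τ, |G' τ| ≤ B) (hβ : -1 < β)
    (hC : ∀ τ, 0 < τ → |G'' τ| ≤ C * τ ^ β) (hm : Measurable G'') :
    HasDerivAt (fun h => ∫ q, G (q.1 * ∏ i, q.2 i) * (Kbm h q.1 * ∏ i, Kbm (T i) (q.2 i))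
        ∂orthantVolume m)
      ((1 / 2) * G' 0 * Kbm t 0 * ∏ i, √(T i / (2 * π)) +
        (1 / 2) * ∫ q, (∏ i, q.2 i) ^ 2 * (Kbm t q.1 * ∏ i, Kbm (T i) (q.2 i)) *
          G'' (q.1 * ∏ i, q.2 i) ∂orthantVolume m) t := by
  obtain ⟨hint, hderiv⟩ := hasDerivAt_integral_mul_Kbm ht hT hGc.measurable hA
  refine hderiv.congr_deriv ?_
  have hint2 : Integrable (fun q : ℝ × (Fin m → ℝ) => (∏ i, q.2 i) ^ 2 *
      (Kbm t q.1 * ∏ i, Kbm (T i) (q.2 i)) * G'' (q.1 * ∏ i, q.2 i)) (orthantVolume m) := by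
    refine ((integrable_rpow_mul_Kbm ht hT hβ).const_mul C).mono' ?_ ?_
    · have h1 : Measurable fun q : ℝ × (Fin m → ℝ) => (∏ i, q.2 i) ^ 2 := by fun_prop
      have h2 : Measurable fun q : ℝ × (Fin m → ℝ) => Kbm t q.1 :=
        (continuous_Kbm t).measurable.comp measurable_fst
      have h3 : Measurable fun q : ℝ × (Fin m → ℝ) => G'' (q.1 * ∏ i, q.2 i) :=
        hm.comp (by fun_prop)
      exact ((h1.mul (h2.mul ((measurable_prod_Kbm T).comp measurable_snd))).mul
        h3).aestronglyMeasurable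
    · filter_upwards [ae_orthantVolume m] with q hq
      have h0 : 0 ≤ (∏ i, q.2 i) ^ 2 * (Kbm t q.1 * ∏ i, Kbm (T i) (q.2 i)) :=
        mul_nonneg (sq_nonneg _) (mul_nonneg (Kbm_nonneg ht _)
          (Finset.prod_nonneg fun i _ => Kbm_nonneg (hT i) _))
      rw [norm_mul, Real.norm_of_nonneg h0]
      calc _ ≤ _ * (C * (q.1 * ∏ i, q.2 i) ^ β) := mul_le_mul_of_nonneg_left
            (hC _ (mul_pos hq.1 (Finset.prod_pos fun i _ => hq.2 i))) h0
        _ = _ := by ring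
  have hint3 : Integrable (fun s : Fin m → ℝ => ∏ i, (s i * Kbm (T i) (s i)))
      (Measure.pi fun _ => posVolume) :=
    Integrable.fintype_prod (ι := Fin m) (f := fun i s => s * Kbm (T i) s)
      (μ := fun _ => posVolume)
      fun i => by simpa [IntegrableOn] using integrableOn_rpow_mul_Kbm (hT i) (p := 1) (by norm_num)
  have hpos : ∀ᵐ s ∂(Measure.pi fun _ : Fin m => posVolume), 0 < ∏ i, s i := by
    rw [← Measure.restrict_pi_pi]
    filter_upwards [ae_restrict_mem (MeasurableSet.univ_pi fun _ => measurableSet_Ioi)] with s hs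
    exact Finset.prod_pos fun i _ => hs i (Set.mem_univ i)
  rw [integral_prod_symm _ hint, integral_prod_symm _ hint2]
  have h1 : ∏ i, √(T i / (2 * π)) =
      ∫ s : Fin m → ℝ, ∏ i, (s i * Kbm (T i) (s i)) ∂(Measure.pi fun _ => posVolume) := by
    rw [integral_fintype_prod_eq_prod (f := fun i s => s * Kbm (T i) s)]
    exact Finset.prod_congr rfl fun i _ => (integral_Ioi_mul_Kbm (hT i)).symm
  rw [h1, ← integral_const_mul, ← integral_const_mul, ← integral_add (hint3.const_mul _)
    (hint2.integral_prod_right.const_mul _)]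
  refine integral_congr_ae ?_
  filter_upwards [hpos] with s hs
  have h2 := integral_Ioi_comp_mul_deriv_Kbm hs ht hGc hGc' hG hG' hA hB hβ hC hm
  have h3 : ∫ r in Set.Ioi 0, G (r * ∏ i, s i) *
        ((1 / 2) * (r ^ 2 / t ^ 2 - 1 / t) * Kbm t r * ∏ i, Kbm (T i) (s i)) =
      (∫ r in Set.Ioi 0, G (r * ∏ i, s i) * ((1 / 2) * (r ^ 2 / t ^ 2 - 1 / t) * Kbm t r)) *
        ∏ i, Kbm (T i) (s i) := by
    rw [← integral_mul_const]; simp only [mul_assoc]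
  have h4 : ∫ r in Set.Ioi 0, (∏ i, s i) ^ 2 * (Kbm t r * ∏ i, Kbm (T i) (s i)) *
        G'' (r * ∏ i, s i) =
      (∫ r in Set.Ioi 0, (∏ i, s i) ^ 2 * G'' (r * ∏ i, s i) * Kbm t r) *
        ∏ i, Kbm (T i) (s i) := by
    rw [← integral_mul_const]; congr 1; funext r; ring
  rw [h3, h4, h2, Finset.prod_mul_distrib]
  ring

lemma lap_const_mul {d : ℕ} (c : ℝ) (F : (Fin d → ℝ) → ℝ) :
    lap (fun x => c * F x) = fun x => c * lap F x := by
  have h : ∀ (k : Fin d) (F : (Fin d → ℝ) → ℝ), pd k (fun x => c * F x) = fun x => c * pd k F x :=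
    fun k F => funext fun x => deriv_const_mul_field c
  funext x
  simp only [lap, h, Finset.mul_sum]

/-- The time derivative of the average of the heat semigroup, as a bilaplacian in space. -/
lemma hasDerivAt_orthant_average_heatSg {m d : ℕ} {f : (Fin d → ℝ) → ℝ}
    {f' f'' : Fin d → (Fin d → ℝ) → ℝ} (h : ∀ k, HasPd k f (f' k))
    (h' : ∀ k, HasPd k (f' k) (f'' k)) (hf : Measurable f) {M M₂ : ℝ} (hM : ∀ x, |f x| ≤ M)
    (hM₂ : ∀ k x, |f'' k x| ≤ M₂) {α H : ℝ} (hα₁ : 0 < α) (hα₂ : α ≤ 1)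
    (hH : ∀ k x y, |f'' k x - f'' k y| ≤ H * dist x y ^ α) {t : ℝ} (ht : 0 < t) {T : Fin m → ℝ}
    (hT : ∀ i, 0 < T i) (x : Fin d → ℝ) :
    HasDerivAt (fun h => ∫ q, heatSg f (q.1 * ∏ i, q.2 i) x *
        (Kbm h q.1 * ∏ i, Kbm (T i) (q.2 i)) ∂orthantVolume m)
      ((1 / 4) * (Kbm t 0 * ∏ i, √(T i / (2 * π))) * lap f x +
        (1 / 8) * lap (lap fun x => ∫ q, (∏ i, q.2 i) ^ 2 *
          (Kbm t q.1 * ∏ i, Kbm (T i) (q.2 i)) * heatSg f (q.1 * ∏ i, q.2 i) x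
            ∂orthantVolume m) x) t := by
  have hM₁ : ∀ k x, |f' k x| ≤ 2 * M + M₂ := fun k => (h k).abs_le_of_second (h' k) hM (hM₂ k)
  set g : (Fin d → ℝ) → ℝ := fun x => ∑ k, f'' k x with hg
  have hlap : lap f = g := lap_eq_of_hasPd h h'
  have hgH : ∀ x y, |g x - g y| ≤ (d * H) * dist x y ^ α := fun x y => by
    rw [hg, ← Finset.sum_sub_distrib]
    refine (Finset.abs_sum_le_sum_abs _ _).trans
      ((Finset.sum_le_sum fun k _ => hH k x y).trans_eq ?_)
    simp [mul_assoc]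
  have hgM : ∀ x, |g x| ≤ d * M₂ := fun x =>
    (Finset.abs_sum_le_sum_abs _ _).trans
      ((Finset.sum_le_sum fun k _ => hM₂ k x).trans_eq (by simp))
  have hgc : Continuous g := continuous_of_holder hα₁ hgH
  obtain ⟨C, hC⟩ := exists_abs_heatInt_weight₂_le hgc.measurable hgM hα₁ hα₂ hgH
  have hsum : ∀ τ, 0 < τ → ∀ x, ∑ k, heatInt (weight₂ k τ) f τ x = heatSg g τ x := by
    intro τ hτ x
    have h1 : ∀ k, heatInt (weight₂ k τ) f τ x = heatSg (f'' k) τ x := fun k =>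
      congrFun (heatInt_weight₂_eq_heatSg k hτ (h k) (h' k) hf hM (hM₁ k) (hM₂ k)) x
    simp only [h1, heatSg, hg, Finset.sum_mul]
    rw [integral_finsetSum]
    exact fun k _ => ((integrable_heat one_pos).const_mul M₂).mono'
      ((((h' k).measurable ((h k).measurable hf)).comp (by fun_prop)).mul
        measurable_heat_one).aestronglyMeasurable
      (Eventually.of_forall fun z => norm_mul_heat_le (hM₂ k _) z)
  have hβ : -1 < α / 2 - 1 := by linarith
  have key := hasDerivAt_orthant_average (G := fun τ => heatSg f τ x)
    (G' := fun τ => (1 / 2) * heatSg g τ x)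
    (G'' := fun τ => (1 / 2) * ((1 / 2) * ∑ k, heatInt (weight₂ k τ) g τ x))
    (A := M) (B := (1 / 2) * (d * M₂)) (C := (1 / 4) * (d * C)) (β := α / 2 - 1) ht hT
    (continuous_heatSg (continuous_of_hasPd h hM₁) hM x)
    ((continuous_heatSg hgc hgM x).const_mul _)
    (fun τ hτ => by rw [← hsum τ hτ]; exact hasDerivAt_heatSg hf hM hτ x)
    (fun τ hτ => (hasDerivAt_heatSg hgc.measurable hgM hτ x).const_mul _)
    (fun τ => abs_heatSg_le hM τ x)
    (fun τ => by
      rw [abs_mul, abs_of_pos one_half_pos]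
      exact mul_le_mul_of_nonneg_left (abs_heatSg_le hgM τ x) one_half_pos.le)
    hβ
    (fun τ hτ => by
      have h1 : |∑ k, heatInt (weight₂ k τ) g τ x| ≤ d * (C * τ ^ (α / 2 - 1)) :=
        (Finset.abs_sum_le_sum_abs _ _).trans
          ((Finset.sum_le_sum fun k _ => hC k τ hτ x).trans_eq (by simp))
      rw [abs_mul, abs_mul, abs_of_pos one_half_pos]
      linarith)
    (((Finset.measurable_sum _ fun k _ =>
      measurable_heatInt (measurable_weight₂ k) hgc.measurable x).const_mul _).const_mul _)
  refine key.congr_deriv ?_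
  have hσ : Measurable fun q : ℝ × (Fin m → ℝ) => q.1 * ∏ i, q.2 i := by fun_prop
  have hσpos : ∀ᵐ q ∂orthantVolume m, 0 < q.1 * ∏ i, q.2 i := by
    filter_upwards [ae_orthantVolume m] with q hq
    exact mul_pos hq.1 (Finset.prod_pos fun i _ => hq.2 i)
  have hW : Integrable (fun q : ℝ × (Fin m → ℝ) => (∏ i, q.2 i) ^ 2 *
      (Kbm t q.1 * ∏ i, Kbm (T i) (q.2 i))) (orthantVolume m) := by
    simpa using integrable_rpow_mul_Kbm ht hT (p := 0) (by norm_num)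
  rw [lap_integral_mul_heatSg hW hσ hf h h' hM hM₁ hM₂,
    lap_integral_mul_heatSg_of_holder hW hσ hσpos hgc.measurable hgM hα₁ hα₂ hgH
      (integrable_rpow_mul_Kbm ht hT (by norm_num)) (integrable_rpow_mul_Kbm ht hT hβ),
    hlap, heatSg_zero]
  have h2 : ∀ q : ℝ × (Fin m → ℝ), (∏ i, q.2 i) ^ 2 * (Kbm t q.1 * ∏ i, Kbm (T i) (q.2 i)) *
      ((1 / 2) * ((1 / 2) * ∑ k, heatInt (weight₂ k (q.1 * ∏ i, q.2 i)) g
        (q.1 * ∏ i, q.2 i) x)) =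
      (1 / 4) * ((∏ i, q.2 i) ^ 2 * (Kbm t q.1 * ∏ i, Kbm (T i) (q.2 i)) *
        ∑ k, heatInt (weight₂ k (q.1 * ∏ i, q.2 i)) g (q.1 * ∏ i, q.2 i) x) := fun q => by ring
  simp only [h2, integral_const_mul]
  ring

lemma two_pow_mul_Kbm_zero_mul_prod {m : ℕ} {t : ℝ} (ht : 0 < t) {T : Fin m → ℝ}
    (hT : ∀ i, 0 < T i) :
    2 ^ (m + 1) * ((1 / 4) * (Kbm t 0 * ∏ i, √(T i / (2 * π)))) =
      √((∏ i, T i) / ((2 : ℝ) ^ ((4 : ℝ) - (m + 1 : ℕ)) * π ^ (m + 1) * t)) := by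
  have hP : 0 ≤ ∏ i, T i := Finset.prod_nonneg fun i _ => (hT i).le
  have hK : Kbm t 0 = √((2 * π * t)⁻¹) := by
    rw [Real.sqrt_inv, Real.sqrt_eq_rpow, ← Real.rpow_neg (by positivity)]
    simp [Kbm, neg_div]
  have h2 : (2 : ℝ) ^ ((4 : ℝ) - (m + 1 : ℕ)) = 2 ^ 4 / 2 ^ (m + 1) := by
    rw [Real.rpow_sub two_pos, Real.rpow_natCast]
    norm_num
  have h4 : (2 : ℝ) ^ (m + 1) * (1 / 4) = √((2 ^ (m + 1) * (1 / 4)) ^ 2) :=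
    (Real.sqrt_sq (by positivity)).symm
  have h5 : ∏ i, √(T i / (2 * π)) = √((∏ i, T i) / (2 * π) ^ m) := by
    rw [← Real.sqrt_prod _ fun i _ => (div_pos (hT i) (by positivity)).le, Finset.prod_div_distrib]
    simp
  rw [← mul_assoc, h4, hK, h5, ← Real.sqrt_mul (by positivity), ← Real.sqrt_mul (by positivity), h2]
  congr 1
  field_simp
  ring

lemma prod_erase_univ_succAbove {m : ℕ} (j : Fin (m + 1)) (s : Fin (m + 1) → ℝ) :
    ∏ i ∈ Finset.univ.erase j, s i = ∏ i, s (j.succAbove i) := by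
  rw [Fin.univ_succAbove m j, Finset.erase_cons, Finset.prod_map]
  rfl

lemma prod_add_eq_sum_filter {n : ℕ} (hn : 1 ≤ n) (A : ℕ → Fin n → ℝ) :
    ∏ j, (A 1 j + A 2 j) = ∏ j, A 1 j + ∏ j, A 2 j +
      ∑ k ∈ Finset.univ.filter (fun k : Fin n → Fin 2 =>
        n + 1 ≤ (∑ j, ((k j : ℕ) + 1)) ∧ (∑ j, ((k j : ℕ) + 1)) ≤ 2 * n - 1),
        ∏ j, A ((k j : ℕ) + 1) j := by
  have h1 : ∏ j, (A 1 j + A 2 j) = ∑ k : Fin n → Fin 2, ∏ j, A ((k j : ℕ) + 1) j := by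
    rw [← Fintype.piFinset_univ,
      ← Finset.prod_univ_sum (fun _ => Finset.univ) fun j (b : Fin 2) => A ((b : ℕ) + 1) j]
    simp [Fin.sum_univ_two]
  have hne : (fun _ => 1 : Fin n → Fin 2) ≠ fun _ => 0 := fun h => by
    simpa using congrFun h ⟨0, hn⟩
  have hmem : ∀ k : Fin n → Fin 2, (n + 1 ≤ (∑ j, ((k j : ℕ) + 1)) ∧
      (∑ j, ((k j : ℕ) + 1)) ≤ 2 * n - 1) ↔ k ≠ (fun _ => 1) ∧ k ≠ fun _ => 0 := by
    intro k
    have hs : ∑ j, ((k j : ℕ) + 1) = ∑ j, (k j : ℕ) + n := by simp [Finset.sum_add_distrib]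
    have h0 : ∑ j, (k j : ℕ) = 0 ↔ k = fun _ => 0 := by
      simp [Finset.sum_eq_zero_iff, funext_iff]
    have hle : ∀ j ∈ Finset.univ, (k j : ℕ) ≤ 1 := fun j _ => by omega
    have h2 : ∑ j, (k j : ℕ) = n ↔ k = fun _ => 1 := by
      have := Finset.sum_eq_sum_iff_of_le hle
      simp only [Finset.sum_const, Finset.card_univ, Fintype.card_fin, smul_eq_mul, mul_one] at this
      simp [this, funext_iff, Fin.ext_iff]
    have h3 : ∑ j, (k j : ℕ) ≤ n := by simpa using Finset.sum_le_sum hle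
    rw [hs, Ne, Ne, ← h0, ← h2]
    omega
  have hset : (Finset.univ.filter (fun k : Fin n → Fin 2 =>
      n + 1 ≤ (∑ j, ((k j : ℕ) + 1)) ∧ (∑ j, ((k j : ℕ) + 1)) ≤ 2 * n - 1)) =
      (Finset.univ.erase fun _ => 0).erase fun _ => 1 := by
    ext k
    rw [Finset.mem_filter, hmem]
    simp
  rw [h1, hset, ← Finset.add_sum_erase _ _ (Finset.mem_univ fun _ => 0),
    ← Finset.add_sum_erase _ _ (Finset.mem_erase.2 ⟨hne, Finset.mem_univ _⟩), ← add_assoc]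
  simp

lemma prod_sqrt_prod_erase_div {n : ℕ} {t : Fin n → ℝ} (ht : ∀ i, 0 < t i) :
    ∏ j, √((∏ i ∈ Finset.univ.erase j, t i) / ((2 : ℝ) ^ ((4 : ℝ) - n) * π ^ n * t j)) =
      √((∏ i, t i) ^ ((n : ℝ) - 2) /
        ((2 : ℝ) ^ (4 * (n : ℝ) - (n : ℝ) ^ 2) * π ^ (n ^ 2))) := by
  have hP : 0 < ∏ i, t i := Finset.prod_pos fun i _ => ht i
  have h1 : ∀ j, (∏ i ∈ Finset.univ.erase j, t i) / ((2 : ℝ) ^ ((4 : ℝ) - n) * π ^ n * t j) =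
      (∏ i, t i) / ((2 : ℝ) ^ ((4 : ℝ) - n) * π ^ n) / t j ^ 2 := fun j => by
    rw [← Finset.mul_prod_erase _ _ (Finset.mem_univ j)]
    have := (ht j).ne'
    field_simp
  have h2 : (2 : ℝ) ^ (4 * (n : ℝ) - (n : ℝ) ^ 2) = ((2 : ℝ) ^ ((4 : ℝ) - n)) ^ n := by
    rw [← Real.rpow_mul_natCast two_pos.le]
    ring_nf
  simp only [h1]
  rw [← Real.sqrt_prod _ fun j _ => by positivity, Finset.prod_div_distrib,
    Finset.prod_pow, Finset.prod_const, Finset.card_univ, Fintype.card_fin, h2,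
    Real.rpow_sub hP, Real.rpow_natCast, Real.rpow_two, div_pow, mul_pow, ← pow_mul, sq n,
    div_right_comm]

/-- the Brownian-time Brownian sheet nonlinear fourth order
interacting PDE:
`∏_j ∂u/∂t_j = √((t₁⋯t_n)^{n-2}/(2^{4n-n²}π^{n²}))(Δ_x f)ⁿ
  + (1/8ⁿ)∏_j Δ_x²𝒰^{(j)} + ∑_{(k₁,…,k_n)∈𝕊_n} ∏_j T_{k_j,j}`. -/
theorem btbs_nonlinear_fourth_order_pde
    (n d : ℕ) (hn : 1 ≤ n) (hd : 1 ≤ d)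
    (f : (Fin d → ℝ) → ℝ) (hmeas : Measurable f) (M : ℝ) (hb : ∀ y, |f y| ≤ M)
    (α : ℝ) (hα1 : 0 < α) (hα2 : α ≤ 1)
    (hf1 : ∀ (l : Fin d) (x : Fin d → ℝ),
      DifferentiableAt ℝ (fun h : ℝ => f (Function.update x l h)) (x l))
    (hf2 : ∀ (k l : Fin d) (x : Fin d → ℝ),
      DifferentiableAt ℝ (fun h : ℝ => pd l f (Function.update x k h)) (x k))
    (M₂ : ℝ) (hb2 : ∀ (k l : Fin d) (x : Fin d → ℝ), |pd k (pd l f) x| ≤ M₂)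
    (H : ℝ) (hH : ∀ (k l : Fin d) (x y : Fin d → ℝ),
      |pd k (pd l f) x - pd k (pd l f) y| ≤ H * dist x y ^ α)
    (E : (Fin n → ℝ) → (Fin d → ℝ) → ℝ)
    (hE : ∀ s x, E s x = ∫ y : Fin d → ℝ, f y * Kbs n d s x y)
    (u : (Fin n → ℝ) → (Fin d → ℝ) → ℝ)
    (hu : ∀ t x, u t x
      = 2 ^ n * ∫ s in {s : Fin n → ℝ | ∀ i, 0 < s i},
          E s x * ∏ i, Kbm (t i) (s i))
    (U : Fin n → (Fin n → ℝ) → (Fin d → ℝ) → ℝ)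
    (hU : ∀ j t x, U j t x
      = 2 ^ n * ∫ s in {s : Fin n → ℝ | ∀ i, 0 < s i},
          (∏ i ∈ Finset.univ.erase j, s i) ^ 2 * E s x * ∏ i, Kbm (t i) (s i))
    (T : ℕ → Fin n → (Fin n → ℝ) → (Fin d → ℝ) → ℝ)
    (hT1 : ∀ (j : Fin n) (t : Fin n → ℝ) (x : Fin d → ℝ),
      T 1 j t x = Real.sqrt ((∏ i ∈ Finset.univ.erase j, t i) /
        ((2 : ℝ) ^ ((4 : ℝ) - n) * π ^ n * t j)) * lap f x)
    (hT2 : ∀ (j : Fin n) (t : Fin n → ℝ) (x : Fin d → ℝ),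
      T 2 j t x = (1 / 8) * lap (lap (U j t)) x) :
    ∀ (t : Fin n → ℝ), (∀ i, 0 < t i) → ∀ x : Fin d → ℝ,
      (∏ j, pd j (fun t' => u t' x) t)
        = Real.sqrt ((∏ i, t i) ^ ((n : ℝ) - 2) /
            ((2 : ℝ) ^ (4 * (n : ℝ) - (n : ℝ) ^ 2) * π ^ (n ^ 2))) *
              (lap f x) ^ n
          + (1 / 8) ^ n * ∏ j, lap (lap (U j t)) x
          + ∑ k ∈ Finset.univ.filter (fun k : Fin n → Fin 2 =>
                n + 1 ≤ (∑ j, ((k j : ℕ) + 1)) ∧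
                  (∑ j, ((k j : ℕ) + 1)) ≤ 2 * n - 1),
              ∏ j, T ((k j : ℕ) + 1) j t x := by
  intro t ht x
  obtain ⟨m, rfl⟩ : ∃ m, n = m + 1 := ⟨n - 1, by omega⟩
  have h : ∀ k, HasPd k f (pd k f) := fun k x => (hf1 k x).hasDerivAt
  have h' : ∀ k, HasPd k (pd k f) (pd k (pd k f)) := fun k x => (hf2 k k x).hasDerivAt
  have hE' : ∀ s : Fin (m + 1) → ℝ, (∀ i, 0 < s i) → ∀ x, E s x = heatSg f (∏ i, s i) x := by
    intro s hs x
    rw [hE, ← heatInt_one_eq_heatSg (Finset.prod_pos fun i _ => hs i)]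
    simp [heatInt, Kbs_eq_heat]
  have hpos : MeasurableSet {s : Fin (m + 1) → ℝ | ∀ i, 0 < s i} := by
    simp only [Set.ofPred_forall]
    exact MeasurableSet.iInter fun i => measurableSet_lt measurable_const (measurable_pi_apply i)
  have hpd : ∀ j, pd j (fun t' => u t' x) t = T 1 j t x + T 2 j t x := by
    intro j
    set T' : Fin m → ℝ := fun i => t (j.succAbove i) with hT'
    have hu' : (fun r => u (Function.update t j r) x) = fun r => 2 ^ (m + 1) *
        ∫ q, heatSg f (q.1 * ∏ i, q.2 i) x * (Kbm r q.1 * ∏ i, Kbm (T' i) (q.2 i))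
          ∂orthantVolume m := by
      funext r
      rw [hu, ← setIntegral_pos_eq_orthantVolume j
        (fun a b => heatSg f (a * ∏ i, b i) x * (Kbm r a * ∏ i, Kbm (T' i) (b i)))]
      congr 1
      refine setIntegral_congr_fun hpos fun s hs => ?_
      simp [hE' s hs, Fin.prod_univ_succAbove _ j, hT', Function.update_of_ne]
    have hU' : U j t = fun x => 2 ^ (m + 1) *
        ∫ q, (∏ i, q.2 i) ^ 2 * (Kbm (t j) q.1 * ∏ i, Kbm (T' i) (q.2 i)) *
          heatSg f (q.1 * ∏ i, q.2 i) x ∂orthantVolume m := by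
      funext x
      rw [hU, ← setIntegral_pos_eq_orthantVolume j
        (fun a b => (∏ i, b i) ^ 2 * (Kbm (t j) a * ∏ i, Kbm (T' i) (b i)) *
          heatSg f (a * ∏ i, b i) x)]
      congr 1
      refine setIntegral_congr_fun hpos fun s hs => ?_
      simp only [hE' s hs, prod_erase_univ_succAbove, Fin.prod_univ_succAbove _ j, hT']
      ring
    have key := (hasDerivAt_orthant_average_heatSg h h' hmeas hb (fun k => hb2 k k) hα1 hα2
      (fun k => hH k k) (ht j) (T := T') (fun i => ht _) x).const_mul ((2 : ℝ) ^ (m + 1))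
    rw [← hu'] at key
    rw [pd, key.deriv, hT1, hT2, hU', lap_const_mul, lap_const_mul, prod_erase_univ_succAbove,
      ← two_pow_mul_Kbm_zero_mul_prod (ht j) (T := T') fun i => ht _]
    ring
  rw [Finset.prod_congr rfl fun j _ => hpd j,
    prod_add_eq_sum_filter hn fun k j => T k j t x]
  simp only [hT1, hT2]
  rw [Finset.prod_mul_distrib, Finset.prod_mul_distrib, prod_sqrt_prod_erase_div ht]
  simp
end
end

section
/- Let f ∈ C²_c(ℝ^d;ℝ) with all second order partial derivatives Hölder continuous with exponent α ∈ (0,1], and define v(s,x) := exp(i(s₁+⋯+s_n)) ∫_{ℝ^d} f(y) p_{is}(x,y) dy for s ∈ ℝⁿ with s₁⋯s_n ≠ 0 and x ∈ ℝ^d. Then for every j ∈ {1,…,n}, writing σ_j(s) := ∏_{k∈{1,…,n}\{j}} s_k, one has ∂v/∂s_j (s,x) = (i/2) σ_j(s) Δ_x v(s,x) + i v(s,x) and ∂²v/∂s_j² (s,x) = −(1/4) σ_j(s)² Δ_x² v(s,x) − σ_j(s) Δ_x v(s,x) − v(s,x). -/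
open MeasureTheory Real Filter Finset

noncomputable section

/-- The squared Euclidean distance, as a complex number. -/
def sqDist {d : ℕ} (x y : Fin d → ℝ) : ℂ := ∑ k, ((x k : ℂ) - y k) ^ 2

/-- The Gaussian factor `C exp(a |x-y|²)` with complex parameters. -/
def cGauss {d : ℕ} (C a : ℂ) (x y : Fin d → ℝ) : ℂ := C * Complex.exp (a * sqDist x y)

/-- The polynomial `P` with `Δ exp(a|x-y|²) = P exp(a|x-y|²)`. -/
def lapPoly {d : ℕ} (a : ℂ) (x y : Fin d → ℝ) : ℂ := 2 * a * d + 4 * a ^ 2 * sqDist x y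

/-- The polynomial `P` with `Δ² exp(a|x-y|²) = P exp(a|x-y|²)`. -/
def bilapPoly {d : ℕ} (a : ℂ) (x y : Fin d → ℝ) : ℂ :=
  lapPoly a x y ^ 2 + 32 * a ^ 3 * sqDist x y + 8 * a ^ 2 * d

@[fun_prop]
lemma continuous_sqDist {d : ℕ} {X : Type*} [TopologicalSpace X] {g h : X → Fin d → ℝ}
    (hg : Continuous g) (hh : Continuous h) : Continuous fun z => sqDist (g z) (h z) := by
  unfold sqDist; fun_prop

lemma integrable_ofReal_mul {d : ℕ} {f : (Fin d → ℝ) → ℝ} (hf : Continuous f)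
    (hsupp : HasCompactSupport f) {g : (Fin d → ℝ) → ℂ} (hg : Continuous g) :
    Integrable fun y => (f y : ℂ) * g y := by
  refine Continuous.integrable_of_hasCompactSupport (by fun_prop) ?_
  exact HasCompactSupport.mul_right (hsupp.comp_left (g := fun r : ℝ => (r : ℂ)) (by simp))

lemma hasDerivAt_integral_ofReal_mul {d : ℕ} {f : (Fin d → ℝ) → ℝ} (hf : Continuous f)
    (hsupp : HasCompactSupport f) {U : Set ℝ} (hU : IsOpen U)
    {G G' : ℝ → (Fin d → ℝ) → ℂ} (hG : ∀ h ∈ U, Continuous (G h))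
    (hG' : ContinuousOn (fun p : ℝ × (Fin d → ℝ) => G' p.1 p.2) (U ×ˢ Set.univ))
    (hderiv : ∀ h ∈ U, ∀ y, HasDerivAt (fun t => G t y) (G' h y) h) {h₀ : ℝ} (hh₀ : h₀ ∈ U) :
    HasDerivAt (fun h => ∫ y, (f y : ℂ) * G h y) (∫ y, (f y : ℂ) * G' h₀ y) h₀ := by
  obtain ⟨ε, hε, hball⟩ := Metric.nhds_basis_closedBall.mem_iff.1 (hU.mem_nhds hh₀)
  have hK : IsCompact (Metric.closedBall h₀ ε ×ˢ tsupport f) :=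
    (isCompact_closedBall h₀ ε).prod hsupp
  obtain ⟨B, hB⟩ := hK.exists_bound_of_continuousOn
    (hG'.mono (Set.prod_mono hball (Set.subset_univ _)))
  have hG'h : Continuous (G' h₀) := by
    rw [← continuousOn_univ]
    exact hG'.comp (f := fun y : Fin d → ℝ => (h₀, y)) (by fun_prop) (fun y _ => ⟨hh₀, trivial⟩)
  refine (hasDerivAt_integral_of_dominated_loc_of_deriv_le (bound := fun y => ‖(f y : ℂ)‖ * B)
    (F' := fun h y => (f y : ℂ) * G' h y)
    (Metric.closedBall_mem_nhds h₀ hε) ?_ (integrable_ofReal_mul hf hsupp (hG h₀ hh₀))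
    (integrable_ofReal_mul hf hsupp hG'h).aestronglyMeasurable ?_ ?_ ?_).2
  · filter_upwards [hU.mem_nhds hh₀] with h hh
    exact (integrable_ofReal_mul hf hsupp (hG h hh)).aestronglyMeasurable
  · refine Eventually.of_forall fun y h hh => ?_
    rw [norm_mul]
    by_cases hy : y ∈ tsupport f
    · exact mul_le_mul_of_nonneg_left (hB (h, y) ⟨hh, hy⟩) (norm_nonneg _)
    · simp [image_eq_zero_of_notMem_tsupport hy]
  · have := integrable_ofReal_mul hf hsupp (g := fun _ => 1) continuous_const
    exact (by simpa using this.norm : Integrable fun y => ‖(f y : ℂ)‖).mul_const B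
  · exact Eventually.of_forall fun y h hh => (hderiv h (hball hh) y).const_mul _

lemma pd_integral_ofReal_mul {d : ℕ} {f : (Fin d → ℝ) → ℝ} (hf : Continuous f)
    (hsupp : HasCompactSupport f) (k : Fin d) {M M' : (Fin d → ℝ) → (Fin d → ℝ) → ℂ}
    (hM : Continuous fun p : (Fin d → ℝ) × (Fin d → ℝ) => M p.1 p.2)
    (hM' : Continuous fun p : (Fin d → ℝ) × (Fin d → ℝ) => M' p.1 p.2)
    (hderiv : ∀ x y, HasDerivAt (fun h : ℝ => M (Function.update x k h) y) (M' x y) (x k)) :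
    pd k (fun x => ∫ y, (f y : ℂ) * M x y) = fun x => ∫ y, (f y : ℂ) * M' x y := by
  funext x
  have := hasDerivAt_integral_ofReal_mul hf hsupp isOpen_univ
    (G := fun h y => M (Function.update x k h) y) (G' := fun h y => M' (Function.update x k h) y)
    (fun h _ => hM.comp (f := fun y => (Function.update x k h, y)) (by fun_prop))
    (hM'.comp (f := fun p : ℝ × (Fin d → ℝ) => (Function.update x k p.1, p.2))
      (by fun_prop)).continuousOn
    (fun h _ y => by simpa using hderiv (Function.update x k h) y) (Set.mem_univ (x k))
  rw [Function.update_eq_self] at this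
  exact this.deriv

lemma lap_integral_ofReal_mul {d : ℕ} {f : (Fin d → ℝ) → ℝ} (hf : Continuous f)
    (hsupp : HasCompactSupport f) {M L : (Fin d → ℝ) → (Fin d → ℝ) → ℂ}
    {M' M'' : Fin d → (Fin d → ℝ) → (Fin d → ℝ) → ℂ}
    (hM : Continuous fun p : (Fin d → ℝ) × (Fin d → ℝ) => M p.1 p.2)
    (hM' : ∀ k, Continuous fun p : (Fin d → ℝ) × (Fin d → ℝ) => M' k p.1 p.2)
    (hM'' : ∀ k, Continuous fun p : (Fin d → ℝ) × (Fin d → ℝ) => M'' k p.1 p.2)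
    (hderiv : ∀ k x y, HasDerivAt (fun h : ℝ => M (Function.update x k h) y) (M' k x y) (x k))
    (hderiv' : ∀ k x y,
      HasDerivAt (fun h : ℝ => M' k (Function.update x k h) y) (M'' k x y) (x k))
    (hL : ∀ x y, ∑ k, M'' k x y = L x y) :
    lap (fun x => ∫ y, (f y : ℂ) * M x y) = fun x => ∫ y, (f y : ℂ) * L x y := by
  funext x
  simp only [lap]
  have h1 (k : Fin d) : pd k (pd k fun x => ∫ y, (f y : ℂ) * M x y) x
      = ∫ y, (f y : ℂ) * M'' k x y := by
    rw [pd_integral_ofReal_mul hf hsupp k hM (hM' k) (hderiv k),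
      pd_integral_ofReal_mul hf hsupp k (hM' k) (hM'' k) (hderiv' k)]
  simp only [h1, ← hL, mul_sum]
  rw [integral_finsetSum]
  exact fun k _ => integrable_ofReal_mul hf hsupp
    ((hM'' k).comp (f := fun y => (x, y)) (by fun_prop))

lemma hasDerivAt_update_sub {d : ℕ} (k : Fin d) (x y : Fin d → ℝ) :
    HasDerivAt (fun h : ℝ => ((Function.update x k h k : ℝ) : ℂ) - y k) 1 (x k) := by
  simpa using (hasDerivAt_id (x k)).ofReal_comp.sub_const (y k : ℂ)

lemma hasDerivAt_sqDist_update {d : ℕ} (k : Fin d) (x y : Fin d → ℝ) :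
    HasDerivAt (fun h : ℝ => sqDist (Function.update x k h) y) (2 * ((x k : ℂ) - y k)) (x k) := by
  have h : ∀ l ∈ Finset.univ, HasDerivAt
      (fun h : ℝ => (((Function.update x k h l : ℝ) : ℂ) - y l) ^ 2)
      (if l = k then 2 * ((x k : ℂ) - y k) else 0) (x k) := by
    intro l _
    split_ifs with hl
    · subst hl
      simpa using (hasDerivAt_update_sub l x y).fun_pow 2
    · simpa [Function.update_of_ne hl] using hasDerivAt_const (x k) (((x l : ℂ) - y l) ^ 2)
  simpa [sqDist] using HasDerivAt.fun_sum h

lemma hasDerivAt_cGauss_update {d : ℕ} (C a : ℂ) (k : Fin d) (x y : Fin d → ℝ) :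
    HasDerivAt (fun h : ℝ => cGauss C a (Function.update x k h) y)
      (2 * a * ((x k : ℂ) - y k) * cGauss C a x y) (x k) := by
  have := (((hasDerivAt_sqDist_update k x y).const_mul a).cexp).const_mul C
  rw [Function.update_eq_self] at this
  exact this.congr_deriv (by simp only [cGauss]; ring)

lemma lap_integral_cGauss {d : ℕ} {f : (Fin d → ℝ) → ℝ} (hf : Continuous f)
    (hsupp : HasCompactSupport f) (C a : ℂ) :
    lap (fun x => ∫ y, (f y : ℂ) * cGauss C a x y)
      = fun x => ∫ y, (f y : ℂ) * (lapPoly a x y * cGauss C a x y) := by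
  refine lap_integral_ofReal_mul hf hsupp
    (M' := fun k x y => 2 * a * ((x k : ℂ) - y k) * cGauss C a x y)
    (M'' := fun k x y => (2 * a + 4 * a ^ 2 * ((x k : ℂ) - y k) ^ 2) * cGauss C a x y)
    ?_ ?_ ?_ (hasDerivAt_cGauss_update C a) ?_ ?_
  · unfold cGauss; fun_prop
  · unfold cGauss; fun_prop
  · unfold cGauss; fun_prop
  · intro k x y
    have := ((hasDerivAt_update_sub k x y).const_mul (2 * a)).mul
      (hasDerivAt_cGauss_update C a k x y)
    simp only [Function.update_eq_self] at this
    exact this.congr_deriv (by ring)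
  · intro x y
    rw [← Finset.sum_mul, Finset.sum_add_distrib]
    simp only [sum_const, card_univ, Fintype.card_fin, nsmul_eq_mul]
    rw [← Finset.mul_sum, ← sqDist, lapPoly]
    ring

lemma lap_integral_lapPoly_mul_cGauss {d : ℕ} {f : (Fin d → ℝ) → ℝ} (hf : Continuous f)
    (hsupp : HasCompactSupport f) (C a : ℂ) :
    lap (fun x => ∫ y, (f y : ℂ) * (lapPoly a x y * cGauss C a x y))
      = fun x => ∫ y, (f y : ℂ) * (bilapPoly a x y * cGauss C a x y) := by
  have hP (k : Fin d) (x y : Fin d → ℝ) :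
      HasDerivAt (fun h : ℝ => lapPoly a (Function.update x k h) y)
        (8 * a ^ 2 * ((x k : ℂ) - y k)) (x k) :=
    (((hasDerivAt_sqDist_update k x y).const_mul (4 * a ^ 2)).const_add (2 * a * d)).congr_deriv
      (by ring)
  refine lap_integral_ofReal_mul hf hsupp
    (M' := fun k x y => (8 * a ^ 2 + 2 * a * lapPoly a x y) * ((x k : ℂ) - y k) * cGauss C a x y)
    (M'' := fun k x y => ((8 * a ^ 2 + 2 * a * lapPoly a x y)
      + (32 * a ^ 3 + 4 * a ^ 2 * lapPoly a x y) * ((x k : ℂ) - y k) ^ 2) * cGauss C a x y)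
    ?_ ?_ ?_ ?_ ?_ ?_
  · unfold cGauss lapPoly; fun_prop
  · unfold cGauss lapPoly; fun_prop
  · unfold cGauss lapPoly; fun_prop
  · intro k x y
    have := (hP k x y).mul (hasDerivAt_cGauss_update C a k x y)
    simp only [Function.update_eq_self] at this
    exact this.congr_deriv (by ring)
  · intro k x y
    have := ((((hP k x y).const_mul (2 * a)).const_add (8 * a ^ 2)).mul
      (hasDerivAt_update_sub k x y)).mul (hasDerivAt_cGauss_update C a k x y)
    simp only [Pi.mul_apply, Function.update_eq_self] at this
    exact this.congr_deriv (by ring)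
  · intro x y
    rw [← Finset.sum_mul, Finset.sum_add_distrib, ← Finset.mul_sum]
    simp only [sum_const, card_univ, Fintype.card_fin, nsmul_eq_mul, bilapPoly]
    rw [← sqDist, lapPoly]
    ring

section TimeDerivative

variable {d : ℕ} {C a : ℝ → ℂ} {σ : ℂ} {t : ℝ}

lemma hasDerivAt_lapPoly_time (ha : HasDerivAt a (2 * Complex.I * σ * a t ^ 2) t)
    (x y : Fin d → ℝ) :
    HasDerivAt (fun h => lapPoly (a h) x y)
      (Complex.I / 2 * σ * (32 * a t ^ 3 * sqDist x y + 8 * a t ^ 2 * d)) t :=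
  (((ha.const_mul 2).mul_const (d : ℂ)).add
    (((ha.pow 2).const_mul 4).mul_const (sqDist x y))).congr_deriv (by
      push_cast; simp only [pow_one]; ring)

lemma hasDerivAt_cGauss_time (ha : HasDerivAt a (2 * Complex.I * σ * a t ^ 2) t)
    (hC : HasDerivAt C (Complex.I * (1 + d * σ * a t) * C t) t) (x y : Fin d → ℝ) :
    HasDerivAt (fun h => cGauss (C h) (a h) x y)
      ((Complex.I / 2 * σ * lapPoly (a t) x y + Complex.I) * cGauss (C t) (a t) x y) t :=
  (hC.mul (ha.mul_const (sqDist x y)).cexp).congr_deriv (by simp only [cGauss, lapPoly]; ring)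

lemma hasDerivAt_lapPoly_mul_cGauss_time (ha : HasDerivAt a (2 * Complex.I * σ * a t ^ 2) t)
    (hC : HasDerivAt C (Complex.I * (1 + d * σ * a t) * C t) t) (x y : Fin d → ℝ) :
    HasDerivAt
      (fun h => (Complex.I / 2 * σ * lapPoly (a h) x y + Complex.I) * cGauss (C h) (a h) x y)
      ((-(1 / 4) * σ ^ 2 * bilapPoly (a t) x y - σ * lapPoly (a t) x y - 1)
        * cGauss (C t) (a t) x y) t := by
  refine ((((hasDerivAt_lapPoly_time ha x y).const_mul (Complex.I / 2 * σ)).add_const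
    Complex.I).mul (hasDerivAt_cGauss_time ha hC x y)).congr_deriv ?_
  simp only [bilapPoly]
  linear_combination ((8 * σ ^ 2 * a t ^ 3 * sqDist x y + 2 * σ ^ 2 * a t ^ 2 * d)
    + (σ / 2 * lapPoly (a t) x y + 1) ^ 2) * cGauss (C t) (a t) x y * Complex.I_sq

end TimeDerivative

/-- The prefactor of the propagator kernel times the phase `exp(i∑s_i)`. -/
def phaseCoeff (n d : ℕ) (s : Fin n → ℝ) : ℂ :=
  Complex.exp (Complex.I * ∑ i, (s i : ℂ)) *
    (2 * (π : ℂ) * Complex.I * ∏ i, (s i : ℂ)) ^ (-(d : ℂ) / 2)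

/-- The exponent rate of the propagator kernel. -/
def phaseRate (n : ℕ) (s : Fin n → ℝ) : ℂ := -1 / (2 * Complex.I * ∏ i, (s i : ℂ))

lemma phase_mul_pProp (n d : ℕ) (s : Fin n → ℝ) (x y : Fin d → ℝ) :
    Complex.exp (Complex.I * ((∑ i, s i : ℝ) : ℂ)) * pProp n d s x y
      = cGauss (phaseCoeff n d s) (phaseRate n s) x y := by
  simp only [pProp, cGauss, phaseCoeff, phaseRate, sqDist, mul_assoc]
  push_cast
  congr 4
  ring

lemma prod_ofReal_update {n : ℕ} (s : Fin n → ℝ) (j : Fin n) (h : ℝ) :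
    ∏ i, ((Function.update s j h i : ℝ) : ℂ) = h * ∏ k ∈ Finset.univ.erase j, (s k : ℂ) := by
  rw [← Finset.mul_prod_erase _ _ (Finset.mem_univ j), Function.update_self]
  congr 1
  exact Finset.prod_congr rfl fun k hk => by
    rw [Function.update_of_ne (Finset.ne_of_mem_erase hk)]

lemma sum_ofReal_update {n : ℕ} (s : Fin n → ℝ) (j : Fin n) (h : ℝ) :
    ∑ i, ((Function.update s j h i : ℝ) : ℂ) = h + ∑ k ∈ Finset.univ.erase j, (s k : ℂ) := by
  rw [← Finset.add_sum_erase _ _ (Finset.mem_univ j), Function.update_self]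
  congr 1
  exact Finset.sum_congr rfl fun k hk => by
    rw [Function.update_of_ne (Finset.ne_of_mem_erase hk)]

lemma hasDerivAt_phaseRate {n : ℕ} (s : Fin n → ℝ) (j : Fin n) {h : ℝ} (hh : h ≠ 0)
    (hσ : ∏ k ∈ Finset.univ.erase j, (s k : ℂ) ≠ 0) :
    HasDerivAt (fun t => phaseRate n (Function.update s j t))
      (2 * Complex.I * (∏ k ∈ Finset.univ.erase j, (s k : ℂ))
        * phaseRate n (Function.update s j h) ^ 2) h := by
  simp only [phaseRate, prod_ofReal_update]
  set σ := ∏ k ∈ Finset.univ.erase j, (s k : ℂ)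
  have hh' : (h : ℂ) ≠ 0 := by exact_mod_cast hh
  have h1 : HasDerivAt (fun t : ℝ => 2 * Complex.I * ((t : ℂ) * σ)) (2 * Complex.I * (1 * σ)) h :=
    ((hasDerivAt_id h).ofReal_comp.mul_const σ).const_mul (2 * Complex.I)
  have hne : 2 * Complex.I * ((h : ℂ) * σ) ≠ 0 := by simp [hh', hσ]
  refine ((hasDerivAt_const h (-1 : ℂ)).div h1 hne).congr_deriv ?_
  field_simp
  ring

lemma hasDerivAt_phaseCoeff {n : ℕ} (d : ℕ) (s : Fin n → ℝ) (j : Fin n) {h : ℝ} (hh : h ≠ 0)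
    (hσ : ∏ k ∈ Finset.univ.erase j, (s k : ℂ) ≠ 0) :
    HasDerivAt (fun t => phaseCoeff n d (Function.update s j t))
      (Complex.I * (1 + d * (∏ k ∈ Finset.univ.erase j, (s k : ℂ))
        * phaseRate n (Function.update s j h)) * phaseCoeff n d (Function.update s j h)) h := by
  simp only [phaseRate, phaseCoeff, prod_ofReal_update, sum_ofReal_update]
  set σ := ∏ k ∈ Finset.univ.erase j, (s k : ℂ) with hσdef
  have hh' : (h : ℂ) ≠ 0 := by exact_mod_cast hh
  have h1 : HasDerivAt (fun t : ℝ => 2 * (π : ℂ) * Complex.I * ((t : ℂ) * σ))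
      (2 * (π : ℂ) * Complex.I * (1 * σ)) h :=
    ((hasDerivAt_id h).ofReal_comp.mul_const σ).const_mul _
  have hne : 2 * (π : ℂ) * Complex.I * ((h : ℂ) * σ) ≠ 0 := by simp [hh', hσ, Real.pi_ne_zero]
  have hslit : 2 * (π : ℂ) * Complex.I * ((h : ℂ) * σ) ∈ Complex.slitPlane := by
    refine Complex.mem_slitPlane_iff.2 (Or.inr fun him => hne ?_)
    have hreal : 2 * (π : ℂ) * Complex.I * ((h : ℂ) * σ)
        = ((2 * π * (h * ∏ k ∈ Finset.univ.erase j, s k) : ℝ) : ℂ) * Complex.I := by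
      rw [hσdef]; push_cast; ring
    rw [hreal, Complex.im_ofReal_mul, Complex.I_im, mul_one] at him
    rw [hreal, him, Complex.ofReal_zero, zero_mul]
  have h2 : HasDerivAt (fun t : ℝ => Complex.exp (Complex.I * ((t : ℂ)
      + ∑ k ∈ Finset.univ.erase j, (s k : ℂ)))) _ h :=
    (((hasDerivAt_id h).ofReal_comp.add_const
      (∑ k ∈ Finset.univ.erase j, (s k : ℂ))).const_mul Complex.I).cexp
  have h3 := (Complex.hasStrictDerivAt_cpow_const (c := -(d : ℂ) / 2) hslit).hasDerivAt.comp h h1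
  refine (h2.mul h3).congr_deriv ?_
  simp only [Function.comp_apply, Complex.ofReal_one]
  rw [Complex.cpow_sub _ _ hne, Complex.cpow_one]
  field_simp
  simp
  ring

/-- first and second `s_j`-partials of
`v(s,x) = exp(i∑s_i)∫ f(y)p_{is}(x,y)dy`:
`∂v/∂s_j = (i/2)σ_j Δ_x v + i v` and
`∂²v/∂s_j² = -(1/4)σ_j² Δ_x² v - σ_j Δ_x v - v`, with `σ_j = ∏_{k≠j}s_k`. -/
theorem vKS_partials
    (n d : ℕ) (hn : 1 ≤ n) (hd : 1 ≤ d)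
    (f : (Fin d → ℝ) → ℝ) (hf : ContDiff ℝ 2 f) (hsupp : HasCompactSupport f)
    (α : ℝ) (hα1 : 0 < α) (hα2 : α ≤ 1)
    (H : ℝ) (hH : ∀ (k l : Fin d) (x y : Fin d → ℝ),
      |pd k (pd l f) x - pd k (pd l f) y| ≤ H * dist x y ^ α)
    (v : (Fin n → ℝ) → (Fin d → ℝ) → ℂ)
    (hv : ∀ s x, v s x
      = Complex.exp (Complex.I * ((∑ i, s i : ℝ) : ℂ)) *
          ∫ y : Fin d → ℝ, (f y : ℂ) * pProp n d s x y)
    (j : Fin n) (s : Fin n → ℝ) (hs : (∏ i, s i) ≠ 0) (x : Fin d → ℝ) :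
    pd j (fun s' => v s' x) s
      = (Complex.I / 2) * (∏ k ∈ Finset.univ.erase j, (s k : ℂ)) * lap (v s) x
        + Complex.I * v s x ∧
    pd j (pd j (fun s' => v s' x)) s
      = -(1 / 4) * (∏ k ∈ Finset.univ.erase j, (s k : ℂ)) ^ 2 *
          lap (lap (v s)) x
        - (∏ k ∈ Finset.univ.erase j, (s k : ℂ)) * lap (v s) x
        - v s x := by
  have hfc : Continuous f := hf.continuous
  set σ := ∏ k ∈ Finset.univ.erase j, (s k : ℂ) with hσdef
  have hprod : (s j : ℂ) * σ ≠ 0 := by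
    rw [hσdef, Finset.mul_prod_erase _ (fun k => (s k : ℂ)) (Finset.mem_univ j)]
    exact_mod_cast hs
  have hσ : σ ≠ 0 := right_ne_zero_of_mul hprod
  have hsj : s j ≠ 0 := by exact_mod_cast left_ne_zero_of_mul hprod
  have hv' (s : Fin n → ℝ) :
      v s = fun x => ∫ y, (f y : ℂ) * cGauss (phaseCoeff n d s) (phaseRate n s) x y := by
    funext x
    rw [hv, ← integral_const_mul]
    simp only [← phase_mul_pProp]
    congr 1 with y
    ring
  have hU : IsOpen {h : ℝ | h ≠ 0} := isOpen_ne
  have ha (h : ℝ) (hh : h ≠ 0) := hasDerivAt_phaseRate s j hh hσ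
  have hC (h : ℝ) (hh : h ≠ 0) := hasDerivAt_phaseCoeff d s j hh hσ
  have hac : ContinuousOn (fun p : ℝ × (Fin d → ℝ) => phaseRate n (Function.update s j p.1))
      ({h : ℝ | h ≠ 0} ×ˢ Set.univ) :=
    fun p hp => (ha p.1 hp.1).continuousAt.comp_continuousWithinAt
      (f := Prod.fst) continuousWithinAt_fst
  have hCc : ContinuousOn (fun p : ℝ × (Fin d → ℝ) => phaseCoeff n d (Function.update s j p.1))
      ({h : ℝ | h ≠ 0} ×ˢ Set.univ) :=
    fun p hp => (hC p.1 hp.1).continuousAt.comp_continuousWithinAt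
      (f := Prod.fst) continuousWithinAt_fst
  have hqc : ContinuousOn (fun p : ℝ × (Fin d → ℝ) => sqDist x p.2)
      ({h : ℝ | h ≠ 0} ×ˢ Set.univ) := by fun_prop
  have hd1 (h : ℝ) (hh : h ≠ 0) := hasDerivAt_integral_ofReal_mul hfc hsupp hU
    (G := fun h y => cGauss (phaseCoeff n d (Function.update s j h))
      (phaseRate n (Function.update s j h)) x y)
    (fun h _ => by unfold cGauss; fun_prop)
    (by unfold lapPoly cGauss; fun_prop)
    (fun h hh y => hasDerivAt_cGauss_time (ha h hh) (hC h hh) x y) hh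
  have hd2 := hasDerivAt_integral_ofReal_mul hfc hsupp hU
    (G := fun h y => (Complex.I / 2 * σ * lapPoly (phaseRate n (Function.update s j h)) x y
      + Complex.I) * cGauss (phaseCoeff n d (Function.update s j h))
        (phaseRate n (Function.update s j h)) x y)
    (fun h _ => by unfold lapPoly cGauss; fun_prop)
    (by unfold bilapPoly lapPoly cGauss; fun_prop)
    (fun h hh y => hasDerivAt_lapPoly_mul_cGauss_time (ha h hh) (hC h hh) x y) hsj
  have hpd (h : ℝ) (hh : h ≠ 0) : pd j (fun s' => v s' x) (Function.update s j h)
      = ∫ y, (f y : ℂ) * ((Complex.I / 2 * σ * lapPoly (phaseRate n (Function.update s j h)) x y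
      + Complex.I) * cGauss (phaseCoeff n d (Function.update s j h))
        (phaseRate n (Function.update s j h)) x y) := by
    simp only [pd, Function.update_idem, Function.update_self, hv']
    exact (hd1 h hh).deriv
  have hi0 := integrable_ofReal_mul hfc hsupp
    (g := fun y => cGauss (phaseCoeff n d s) (phaseRate n s) x y) (by unfold cGauss; fun_prop)
  have hi1 := integrable_ofReal_mul hfc hsupp
    (g := fun y => lapPoly (phaseRate n s) x y * cGauss (phaseCoeff n d s) (phaseRate n s) x y)
    (by unfold lapPoly cGauss; fun_prop)
  have hi2 := integrable_ofReal_mul hfc hsupp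
    (g := fun y => bilapPoly (phaseRate n s) x y * cGauss (phaseCoeff n d s) (phaseRate n s) x y)
    (by unfold bilapPoly lapPoly cGauss; fun_prop)
  have hi12 : Integrable fun y =>
      -(1 / 4) * σ ^ 2 *
          ((f y : ℂ) * (bilapPoly (phaseRate n s) x y * cGauss (phaseCoeff n d s) (phaseRate n s) x y))
        - σ * ((f y : ℂ) *
          (lapPoly (phaseRate n s) x y * cGauss (phaseCoeff n d s) (phaseRate n s) x y)) :=
    (hi2.const_mul _).sub (hi1.const_mul _)
  rw [hv' s, lap_integral_cGauss hfc hsupp, lap_integral_lapPoly_mul_cGauss hfc hsupp]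
  constructor
  · have h1 := hpd (s j) hsj
    rw [Function.update_eq_self] at h1
    rw [h1, ← integral_const_mul, ← integral_const_mul,
      ← integral_add (hi1.const_mul _) (hi0.const_mul _)]
    congr 1 with y
    ring
  · have h2 := (hd2.congr_of_eventuallyEq
      (f₁ := fun h => pd j (fun s' => v s' x) (Function.update s j h))
      (by filter_upwards [hU.mem_nhds hsj] with h hh using hpd h hh)).deriv
    rw [Function.update_eq_self] at h2
    rw [pd, h2, ← integral_const_mul, ← integral_const_mul,
      ← integral_sub (hi2.const_mul _) (hi1.const_mul _),
      ← integral_sub hi12 hi0]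
    congr 1 with y
    ring
end
end
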